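/- For each n ≥ 1 let 𝓜_n denote the (finite, nonempty) set of pairs (F, M) where F is an acyclic simple graph (forest) on the vertex set Fin n and M is a maximal matching of F, let m_n = |𝓜_n|, and let Ē_n = (Σ_{(F,M) ∈ 𝓜_n} |M|) / m_n be the expected number of edges of a uniformly random element of 𝓜_n. Then there exist real constants λ > 0 and K ≥ 0 such that |Ē_n − λ·n| ≤ K for all n ≥ 1. -/

import Mathlib

open Filter Topology MeasureTheory

/-- `M` is a matching of `G`: a set of edges of `G`, no two distinct
edges of which share a vertex. -/
def IsMatching {V : Type*} (G : SimpleGraph V) (M : Set (Sym2 V)) : Prop :=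
  M ⊆ G.edgeSet ∧ ∀ e ∈ M, ∀ f ∈ M, e ≠ f → ∀ v : V, v ∈ e → v ∉ f

/-- `M` is a maximal matching of `G`. -/
def IsMaximalMatching {V : Type*} (G : SimpleGraph V) (M : Set (Sym2 V)) : Prop :=
  IsMatching G M ∧ ∀ M' : Set (Sym2 V), IsMatching G M' → ¬ M ⊂ M'

/-- The pairs `(F, M)` where `F` is a forest (acyclic simple graph) on `Fin n`
and `M` is a maximal matching of `F`. -/
def MMSpace (n : ℕ) :=
  {p : SimpleGraph (Fin n) × Set (Sym2 (Fin n)) // p.1.IsAcyclic ∧ IsMaximalMatching p.1 p.2}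

/-- `mN n` is the number of pairs `(F, M)` where `F` is a forest on `Fin n`
and `M` is a maximal matching of `F`. -/
noncomputable def mN (n : ℕ) : ℕ := Nat.card (MMSpace n)

/-- The expected number of edges of a uniformly random maximal matching–forest
pair on `n` vertices: the arithmetic mean of `|M|` over all pairs `(F, M)`. -/
noncomputable def Ebar (n : ℕ) : ℝ :=
  (∑ᶠ p : MMSpace n, (p.val.2.ncard : ℝ)) / (mN n : ℝ)

theorem exists_root : ∃ l : ℝ, 0 < l ∧ l < 1/2 ∧
    (1 - 2*l)^2 = 4 * l^3 * Real.exp (2 - 1/l) := by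
  have hc : ContinuousOn (fun x : ℝ => (1 - 2*x)^2 - 4 * x^3 * Real.exp (2 - 1/x))
      (Set.Icc (1/4) (1/2)) := by
    have : ∀ x ∈ Set.Icc (1/4 : ℝ) (1/2), x ≠ 0 := fun x hx => by
      have := hx.1; positivity
    fun_prop (disch := assumption)
  have h := intermediate_value_Ioo' (by norm_num) hc
  have h0 : (0:ℝ) ∈ Set.Ioo ((fun x : ℝ => (1 - 2*x)^2 - 4 * x^3 * Real.exp (2 - 1/x)) (1/2))
      ((fun x : ℝ => (1 - 2*x)^2 - 4 * x^3 * Real.exp (2 - 1/x)) (1/4)) := by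
    constructor
    · norm_num
    · have : Real.exp (-2 : ℝ) ≤ 1 := Real.exp_le_one_iff.2 (by norm_num)
      norm_num
      linarith
  obtain ⟨x, hx, hx0⟩ := h h0
  exact ⟨x, by linarith [hx.1], hx.2, by linarith [hx0]⟩

/-- The drift of the matching size at density `x`. -/
noncomputable def drift (x : ℝ) : ℝ := (1 - 2*x)^2 - 4 * x^3 * Real.exp (2 - 1/x)

theorem drift_monotone_bound {l x : ℝ} (hl : 0 < l) (hx : 0 < x) (hx2 : x ≤ 1/2)
    (h0 : drift l = 0) :
    (2 - 4*l) * (x - l)^2 ≤ -((x - l) * drift x) := by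
  unfold drift at *
  have key : ∀ a b : ℝ, 0 < a → a ≤ b →
      a^3 * Real.exp (2 - 1/a) ≤ b^3 * Real.exp (2 - 1/b) := by
    intro a b ha hab
    have hb : 0 < b := ha.trans_le hab
    have : 1/b ≤ 1/a := one_div_le_one_div_of_le ha hab
    gcongr
  rcases le_total x l with h | h
  · have := key x l hx h
    nlinarith [mul_nonneg (sub_nonneg.2 h) (sub_nonneg.2 this),
      mul_nonneg (sq_nonneg (x-l)) (sub_nonneg.2 hx2)]
  · have := key l x hl h
    nlinarith [mul_nonneg (sub_nonneg.2 h) (sub_nonneg.2 this),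
      mul_nonneg (sq_nonneg (x-l)) (sub_nonneg.2 hx2)]

theorem abs_exp_sub_le {B u : ℝ} (hu : u ≤ B) (hB : 0 ≤ B) :
    |Real.exp u - 1 - u| ≤ Real.exp B * u^2 := by
  have h1 : 0 ≤ Real.exp u - 1 - u := by linarith [Real.add_one_le_exp u]
  rw [abs_of_nonneg h1]
  have h2 : 1 - u ≤ Real.exp (-u) := by linarith [Real.add_one_le_exp (-u)]
  have h3 : Real.exp u * Real.exp (-u) = 1 := by rw [← Real.exp_add]; simp
  have hBe : Real.exp u ≤ Real.exp B := Real.exp_le_exp.2 hu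
  have hB1 : 1 ≤ Real.exp B := Real.one_le_exp hB
  have hp := Real.exp_pos u
  rcases le_total 0 u with h | h
  · have : Real.exp u - 1 ≤ u * Real.exp u := by nlinarith
    nlinarith [sq_nonneg u]
  · have : Real.exp u - 1 ≤ u * Real.exp u := by nlinarith
    nlinarith [sq_nonneg u]

theorem drift_linear_bound {l : ℝ} (hl : 0 < l) (hl2 : l < 1/2) (h0 : drift l = 0) :
    ∃ g C : ℝ, 0 < g ∧ 0 ≤ C ∧ ∀ x : ℝ, 0 < x → x ≤ 1/2 →
      |drift x + g * (x - l)| ≤ C * (x - l)^2 := by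
  set E := Real.exp (2 - 1/l) with hE
  have hEp : 0 < E := Real.exp_pos _
  refine ⟨4*(1-2*l) + (12*l^2 + 4*l) * E, 4 + 4 * E * (4 + 1 / l + Real.exp (1/l) / l^2),
    by nlinarith [mul_pos hl hEp, mul_pos (mul_pos hl hl) hEp], by positivity, ?_⟩
  intro x hx hx2
  set u := 1/l - 1/x with hu
  have hexp : Real.exp (2 - 1/x) = E * Real.exp u := by
    rw [hE, ← Real.exp_add]; congr 1; rw [hu]; ring
  have hub : u ≤ 1/l := by
    have : 0 < 1/x := by positivity
    linarith
  have hb := abs_exp_sub_le hub (by positivity)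
  set R := Real.exp u - 1 - u with hR
  have hxu : x * u = (x - l) / l := by rw [hu]; field_simp
  have hx3R : |x^3 * R| ≤ Real.exp (1/l) / l^2 * (x-l)^2 := by
    rw [abs_mul, abs_of_pos (by positivity)]
    calc x^3 * |R| ≤ x^3 * (Real.exp (1/l) * u^2) := by gcongr
      _ = x * (Real.exp (1/l) * (x*u)^2) := by ring
      _ = x * (Real.exp (1/l) / l^2 * (x-l)^2) := by rw [hxu]; field_simp
      _ ≤ 1 * (Real.exp (1/l) / l^2 * (x-l)^2) := by gcongr; linarith
      _ = _ := one_mul _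
  have h0' : (1 - 2*l)^2 = 4 * l^3 * E := by unfold drift at h0; linarith
  have hx3u : x^3 * u = x^2 * (x - l) / l := by
    rw [show x^3 * u = x^2 * (x*u) by ring, hxu]; ring
  have hdr : drift x = (1-2*x)^2 - 4 * E * (x^3 + x^2 * (x-l)/l + x^3 * R) := by
    unfold drift
    rw [hexp, ← hx3u, show Real.exp u = R + 1 + u by rw [hR]; ring]
    ring
  have hid : drift x + (4*(1-2*l) + (12*l^2 + 4*l) * E) * (x - l)
      = 4 * (x-l)^2 - 4 * E * ((x + 2*l + (x + l)/l) * (x-l)^2 + x^3 * R) := by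
    rw [hdr]
    field_simp
    linear_combination (l) * h0'
  rw [hid]
  have hq : 0 ≤ (x-l)^2 := sq_nonneg _
  have h5 : x/l ≤ (1/l) / 2 := by rw [div_div, div_le_div_iff₀ hl (by positivity)]; nlinarith
  have h6 : (x + l)/l = x/l + 1 := by field_simp
  have h7 : 0 ≤ x / l := by positivity
  have h8 : 0 ≤ 1 / l := by positivity
  have h9 : (x + 2*l + (x+l)/l) * (x-l)^2 ≤ (4 + 1/l) * (x-l)^2 := by
    refine mul_le_mul_of_nonneg_right ?_ hq
    rw [h6]; linarith
  have h10 : 0 ≤ (x + 2*l + (x+l)/l) * (x-l)^2 := by positivity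
  have h11 := abs_le.1 hx3R
  have h12 := mul_le_mul_of_nonneg_left (add_le_add h9 h11.2) hEp.le
  have h13 := mul_le_mul_of_nonneg_left (add_le_add h10 h11.1) hEp.le
  have h14 : 0 ≤ E * ((4 + 1 / l) * (x - l)^2) := by positivity
  rw [abs_le]
  constructor <;> linarith

theorem birth_bound {n k : ℕ} (hk : 1 ≤ k) (hkn : 2 * k ≤ n) :
    |((n:ℝ) - 2*k) * (n - 2*k - 1) / n
      - 4 * (k:ℝ)^3 / n^2 * (((k:ℝ) - 1)/k)^(n - 2*k + 1) - n * drift (k/n)| ≤ 3 := by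
  have hn : 1 ≤ n := by omega
  obtain ⟨m, rfl⟩ := Nat.exists_eq_add_of_le hkn
  have hm : 2 * k + m - 2 * k + 1 = m + 1 := by omega
  rw [hm]
  set N : ℝ := ((2*k+m : ℕ) : ℝ) with hN
  have hNe : N = 2*k + m := by rw [hN]; push_cast; ring
  have hk1 : (1:ℝ) ≤ k := by exact_mod_cast hk
  have hk0 : (0:ℝ) < k := by linarith
  have hm0 : (0:ℝ) ≤ m := by positivity
  have hN0 : 0 < N := by rw [hNe]; positivity
  set q : ℝ := ((k:ℝ) - 1)/k with hq
  have hq' : q = 1 - 1/k := by rw [hq]; field_simp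
  have hki : 1/(k:ℝ) ≤ 1 := by rw [div_le_one hk0]; exact hk1
  have hq0 : 0 ≤ q := by rw [hq']; linarith
  have hqe : q ≤ Real.exp (-(1/k)) := by
    rw [hq']; linarith [Real.add_one_le_exp (-(1/(k:ℝ)))]
  have hqe2 : Real.exp (-(1/k)) - q ≤ (1/(k:ℝ))^2 := by
    have h1 := abs_exp_sub_le (B := 0) (u := -(1/(k:ℝ))) (by simp) le_rfl
    rw [Real.exp_zero] at h1
    have := (abs_le.1 h1).2
    rw [hq']; linarith
  set p := Real.exp (-(1/(k:ℝ))) with hp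
  have hp1 : p ≤ 1 := Real.exp_le_one_iff.2 (by simp)
  have hp0 : 0 < p := Real.exp_pos _
  have hpow : p^(m) - q^(m+1) ≤ (1/k) + (m+1) * (1/(k:ℝ))^2 := by
    have h1 : p^m - p^(m+1) ≤ 1/k := by
      have : p^m ≤ 1 := pow_le_one₀ hp0.le hp1
      have h3 : 1 - 1/(k:ℝ) ≤ p := by rw [← hq']; exact hqe
      have h4 : 0 ≤ p^m := by positivity
      rw [pow_succ]; nlinarith
    have h2 : ∀ j : ℕ, p^j - q^j ≤ j * (1/(k:ℝ))^2 := by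
      intro j
      induction j with
      | zero => simp
      | succ j ih =>
        have : p^j ≤ 1 := pow_le_one₀ hp0.le hp1
        have h5 : 0 ≤ p^j := by positivity
        have h6 : p^(j+1) - q^(j+1) = p^j * (p - q) + q * (p^j - q^j) := by ring
        have h7 : q ≤ 1 := hqe.trans hp1
        have h8 : 0 ≤ p^j - q^j := sub_nonneg.2 (pow_le_pow_left₀ hq0 hqe j)
        rw [h6]; push_cast; nlinarith
    have := h2 (m+1)
    push_cast at this
    linarith
  have hpow0 : 0 ≤ p^m - q^(m+1) := by
    have h1 : q^m ≤ p^m := pow_le_pow_left₀ hq0 hqe m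
    have h7 : q ≤ 1 := hqe.trans hp1
    have : q^(m+1) ≤ q^m := by rw [pow_succ]; nlinarith [pow_nonneg hq0 m]
    linarith
  have hdr : N * drift (k/N) = m^2/N - 4 * k^3/N^2 * p^m := by
    unfold drift
    have : Real.exp (2 - 1/((k:ℝ)/N)) = p^m := by
      rw [hp, ← Real.exp_nat_mul]; congr 1; rw [hNe]; field_simp; ring
    rw [this]
    have : (m:ℝ) = N - 2*k := by rw [hNe]; ring
    rw [this]; field_simp
  rw [hdr]
  have e1 : (N - 2*k) * (N - 2*k - 1)/N - 4 * (k:ℝ)^3/N^2 * q^(m+1) - (m^2/N - 4 * k^3/N^2*p^m)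
      = 4 * (k:ℝ)^3/N^2 * (p^m - q^(m+1)) - m/N := by
    have : N - 2*k = m := by rw [hNe]; ring
    rw [this]; ring
  rw [e1]
  have h1 : 0 ≤ m/N := by positivity
  have h2 : m/N ≤ 1 := by rw [div_le_one hN0, hNe]; linarith
  have h3 : 0 ≤ 4 * (k:ℝ)^3/N^2 * (p^m - q^(m+1)) := by positivity
  have h4 : 4 * (k:ℝ)^3/N^2 * (p^m - q^(m+1)) ≤ 3 := by
    calc 4 * (k:ℝ)^3/N^2 * (p^m - q^(m+1))
        ≤ 4 * (k:ℝ)^3/N^2 * ((1/k) + (m+1) * (1/(k:ℝ))^2) := by gcongr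
      _ = 4 * (k^2 + (m+1)*k) / N^2 := by field_simp
      _ ≤ 3 := by
        rw [div_le_iff₀ (by positivity), hNe]
        nlinarith [mul_nonneg hk0.le hm0]
  rw [abs_le]; constructor <;> linarith
theorem sum_shift (N : ℕ) (α β a φ : ℕ → ℝ) (h0 : β 1 = 0) (h1 : α N = 0) (hN : 1 ≤ N)
    (hrec : ∀ k, 1 ≤ k → k + 1 ≤ N → α k * a k = β (k+1) * a (k+1)) :
    ∑ k ∈ Finset.Icc 1 N, a k * (α k * φ k) = ∑ k ∈ Finset.Icc 1 N, a k * (β k * φ (k-1)) := by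
  obtain ⟨N, rfl⟩ := Nat.exists_eq_add_of_le' hN
  have h2 : ∀ f : ℕ → ℝ, ∑ k ∈ Finset.Icc 1 (N+1), f k = ∑ k ∈ Finset.range (N+1), f (k+1) := by
    intro f
    rw [Finset.range_eq_Ico, Finset.sum_Ico_add' f 0 (N+1) 1]
    rfl
  rw [h2, h2, Finset.sum_range_succ, Finset.sum_range_succ' (fun k => a (k+1) * _)]
  rw [h1, h0]
  simp only [zero_mul, mul_zero, add_zero]
  refine Finset.sum_congr rfl fun k hk => ?_
  rw [Finset.mem_range] at hk
  have := hrec (k+1) (by omega) (by omega)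
  simp only [Nat.add_sub_cancel]
  linear_combination φ (k+1) * this

theorem mean_bound : ∃ l K : ℝ, 0 < l ∧ 0 ≤ K ∧ ∀ n : ℕ, 2 ≤ n → ∀ a : ℕ → ℝ, (∀ k, 0 ≤ a k) →
    (∀ k, 1 ≤ k → 2 * k + 2 ≤ n → (n:ℝ) * ((n - 2*k) * (n - 2*k - 1)) * a k
      = 4 * (k+1)^3 * ((k:ℝ)/(k+1))^(n - 2*k - 1) * a (k+1)) →
    |∑ k ∈ Finset.Icc 1 (n/2), a k * (k - l * n)| ≤ K * ∑ k ∈ Finset.Icc 1 (n/2), a k := by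
  obtain ⟨l, hl, hl2, hroot⟩ := exists_root
  have hd0 : drift l = 0 := by unfold drift; linarith
  obtain ⟨g, C, hg, hC, hlin⟩ := drift_linear_bound hl hl2 hd0
  set c := 2 - 4 * l with hc
  have hcp : 0 < c := by linarith
  set C₁ := (2 / c) * (1 + 9 / (2 * c)) with hC₁
  have hC₁p : 0 < C₁ := by positivity
  refine ⟨l, (3 + C * C₁) / g, hl, by positivity, ?_⟩
  intro n hn a ha hrec
  have hn0 : (0:ℝ) < n := by positivity
  have hn1 : (1:ℝ) ≤ n := by exact_mod_cast (by omega : 1 ≤ n)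
  set α : ℕ → ℝ := fun k => ((n:ℝ) - 2*k) * (n - 2*k - 1) / n with hα
  set β : ℕ → ℝ := fun k => 4 * (k:ℝ)^3 / n^2 * (((k:ℝ) - 1)/k)^(n - 2*k + 1) with hβ
  have hβ1 : β 1 = 0 := by simp [hβ]
  have hαN : α (n/2) = 0 := by
    rcases Nat.even_or_odd' n with ⟨m, rfl | rfl⟩
    · simp [hα]
    · have : (2*m+1)/2 = m := by omega
      simp only [hα, this]; push_cast; ring
  have hr : ∀ k, 1 ≤ k → k + 1 ≤ n/2 → α k * a k = β (k+1) * a (k+1) := by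
    intro k hk hkn
    have h := hrec k hk (by omega)
    have e : n - 2*(k+1) + 1 = n - 2*k - 1 := by omega
    simp only [hα, hβ]
    rw [e]
    push_cast
    rw [add_sub_cancel_right]
    have : ((n:ℝ) - 2*k) * (n - 2*k - 1) / n * a k
      = ((n:ℝ) * ((n - 2*k) * (n - 2*k - 1)) * a k) / n^2 := by field_simp
    rw [this, h]; ring
  have hshift := fun φ => sum_shift (n/2) α β a φ hβ1 hαN (by omega) hr
  set A := ∑ k ∈ Finset.Icc 1 (n/2), a k with hA
  have hA0 : 0 ≤ A := Finset.sum_nonneg fun k _ => ha k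
  have hest : ∀ k ∈ Finset.Icc 1 (n/2), |α k - β k - n * drift (k/n)| ≤ 3 := by
    intro k hk
    rw [Finset.mem_Icc] at hk
    exact birth_bound hk.1 (by omega)
  have hx : ∀ k ∈ Finset.Icc 1 (n/2), 0 < (k:ℝ)/n ∧ (k:ℝ)/n ≤ 1/2 := by
    intro k hk
    rw [Finset.mem_Icc] at hk
    have h1 : (0:ℝ) < k := by exact_mod_cast hk.1
    have h2 : (2:ℝ) * k ≤ n := by exact_mod_cast (by omega : 2 * k ≤ n)
    refine ⟨by positivity, ?_⟩
    rw [div_le_iff₀ hn0]; linarith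
  have hβle : ∀ k ∈ Finset.Icc 1 (n/2), β k ≤ n := by
    intro k hk
    obtain ⟨-, h2⟩ := hx k hk
    rw [Finset.mem_Icc] at hk
    have h1 : (1:ℝ) ≤ k := by exact_mod_cast hk.1
    have hk0 : (0:ℝ) < k := by linarith
    rw [div_le_iff₀ hn0] at h2
    have hq1 : ((k:ℝ) - 1)/k ≤ 1 := by rw [div_le_one hk0]; linarith
    have hq0 : 0 ≤ ((k:ℝ) - 1)/k := div_nonneg (by linarith) hk0.le
    have hp : (((k:ℝ) - 1)/k)^(n - 2*k + 1) ≤ 1 := pow_le_one₀ hq0 hq1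
    calc β k ≤ 4 * (k:ℝ)^3 / n^2 * 1 := by simp only [hβ]; gcongr
      _ ≤ n := by
        rw [mul_one, div_le_iff₀ (by positivity)]
        have : (k:ℝ)^3 ≤ (1/2 * n)^3 := by gcongr
        nlinarith [pow_pos hn0 3]
  have hvar : ∑ k ∈ Finset.Icc 1 (n/2), a k * (k - l*n)^2 ≤ C₁ * n * A := by
    have h := hshift (fun k => k - l * n)
    have h2 : ∑ k ∈ Finset.Icc 1 (n/2), a k * ((k - l*n) * (α k - β k) + β k) = 0 := by
      rw [← sub_eq_zero, ← Finset.sum_sub_distrib] at h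
      rw [← h]
      refine Finset.sum_congr rfl fun k hk => ?_
      rw [Finset.mem_Icc] at hk
      rw [Nat.cast_sub hk.1]; push_cast; ring
    have h3 : ∑ k ∈ Finset.Icc 1 (n/2), a k * ((c/2) * (k - l*n)^2 - (n + 9/(2*c)))
        ≤ ∑ k ∈ Finset.Icc 1 (n/2), -(a k * ((k - l*n) * (α k - β k) + β k)) := by
      refine Finset.sum_le_sum fun k hk => ?_
      rw [← mul_neg]
      refine mul_le_mul_of_nonneg_left ?_ (ha k)
      obtain ⟨hx1, hx2⟩ := hx k hk
      have hm := drift_monotone_bound hl hx1 hx2 hd0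
      have he := abs_le.1 (hest k hk)
      have hb := hβle k hk
      have hkl : (k:ℝ)/n - l = (k - l*n)/n := by field_simp
      rw [hkl] at hm
      set d := (k:ℝ) - l*n with hd
      have hm' : c * d^2 ≤ -(d * (n * drift (k/n))) := by
        have := mul_le_mul_of_nonneg_left hm (sq_nonneg (n:ℝ))
        have e1 : (n:ℝ)^2 * ((2 - 4*l) * (d/n)^2) = c * d^2 := by rw [hc]; field_simp
        have e2 : (n:ℝ)^2 * -(d/n * drift (k/n)) = -(d * (n * drift (k/n))) := by field_simp
        rw [e1, e2] at this; exact this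
      have hdr : -(d * (α k - β k - n * drift (k/n))) ≥ -(3 * |d|) := by
        have : |d * (α k - β k - n * drift (k/n))| ≤ |d| * 3 := by
          rw [abs_mul]; exact mul_le_mul_of_nonneg_left (hest k hk) (abs_nonneg _)
        have := (abs_le.1 this).2
        linarith
      have hy : 3 * |d| ≤ (c/2) * d^2 + 9/(2*c) := by
        have h1 : 0 ≤ (c * |d| - 3)^2 := sq_nonneg _
        have h2 : (c/2) * d^2 + 9/(2*c) - 3 * |d| = (c * |d| - 3)^2 / (2*c) := by
          rw [← sq_abs d]; field_simp; ring
        have h3 : 0 ≤ (c * |d| - 3)^2 / (2*c) := by positivity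
        linarith
      nlinarith
    rw [Finset.sum_neg_distrib, h2, neg_zero] at h3
    simp only [mul_sub, Finset.sum_sub_distrib, ← Finset.sum_mul] at h3
    have h4 : ∑ k ∈ Finset.Icc 1 (n/2), a k * (c/2 * (k - l*n)^2)
        = c/2 * ∑ k ∈ Finset.Icc 1 (n/2), a k * (k - l*n)^2 := by
      rw [Finset.mul_sum]; exact Finset.sum_congr rfl fun k _ => by ring
    rw [h4] at h3
    have h5 : A * (n + 9/(2*c)) ≤ A * (n * (1 + 9/(2*c))) := by
      refine mul_le_mul_of_nonneg_left ?_ hA0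
      have : 0 < 9/(2*c) := by positivity
      nlinarith
    calc ∑ k ∈ Finset.Icc 1 (n/2), a k * (k - l*n)^2
        = 2/c * (c/2 * ∑ k ∈ Finset.Icc 1 (n/2), a k * (k - l*n)^2) := by field_simp
      _ ≤ 2/c * (A * (n * (1 + 9/(2*c)))) := by
        refine mul_le_mul_of_nonneg_left ?_ (by positivity)
        linarith
      _ = C₁ * n * A := by rw [hC₁]; ring
  have hmean : ∑ k ∈ Finset.Icc 1 (n/2), a k * (α k - β k) = 0 := by
    have h := hshift (fun _ => 1)
    rw [← sub_eq_zero, ← Finset.sum_sub_distrib] at h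
    rw [← h]
    exact Finset.sum_congr rfl fun k _ => by ring
  have hfin : |∑ k ∈ Finset.Icc 1 (n/2), a k * (g * (k - l*n))|
      ≤ ∑ k ∈ Finset.Icc 1 (n/2), a k * (3 + C * (k - l*n)^2 / n) := by
    have : ∑ k ∈ Finset.Icc 1 (n/2), a k * (g * (k - l*n))
        = ∑ k ∈ Finset.Icc 1 (n/2), a k * (g * (k - l*n) + (α k - β k)) := by
      simp only [mul_add, Finset.sum_add_distrib]
      rw [hmean, add_zero]
    rw [this]
    refine (Finset.abs_sum_le_sum_abs _ _).trans (Finset.sum_le_sum fun k hk => ?_)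
    rw [abs_mul, abs_of_nonneg (ha k)]
    refine mul_le_mul_of_nonneg_left ?_ (ha k)
    obtain ⟨hx1, hx2⟩ := hx k hk
    have h1 := hlin _ hx1 hx2
    have hkl : (k:ℝ)/n - l = (k - l*n)/n := by field_simp
    rw [hkl] at h1
    have h2 := hest k hk
    have e : g * (k - l*n) + (α k - β k)
        = (α k - β k - n * drift (k/n)) + n * (drift (k/n) + g * ((k - l*n)/n)) := by
      field_simp; ring
    rw [e]
    refine (abs_add_le _ _).trans (add_le_add h2 ?_)
    rw [abs_mul, abs_of_pos hn0]
    calc (n:ℝ) * |drift (k/n) + g * ((k - l*n)/n)| ≤ n * (C * ((k - l*n)/n)^2) := by gcongr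
      _ = _ := by field_simp
  have e1 : ∑ k ∈ Finset.Icc 1 (n/2), a k * (g * (k - l*n))
      = g * ∑ k ∈ Finset.Icc 1 (n/2), a k * (k - l*n) := by
    rw [Finset.mul_sum]; exact Finset.sum_congr rfl fun k _ => by ring
  have e2 : ∑ k ∈ Finset.Icc 1 (n/2), a k * (3 + C * (k - l*n)^2 / n)
      = 3 * A + C / n * ∑ k ∈ Finset.Icc 1 (n/2), a k * (k - l*n)^2 := by
    rw [hA, Finset.mul_sum, Finset.mul_sum, ← Finset.sum_add_distrib]
    exact Finset.sum_congr rfl fun k _ => by ring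
  rw [e1, e2, abs_mul, abs_of_pos hg] at hfin
  have h6 : C / n * ∑ k ∈ Finset.Icc 1 (n/2), a k * (k - l*n)^2 ≤ C * C₁ * A := by
    calc _ ≤ C / n * (C₁ * n * A) := by gcongr
      _ = _ := by field_simp
  rw [div_mul_eq_mul_div, le_div_iff₀ hg]
  linarith

section FunctionCount

open scoped Classical

variable {V : Type*}

/-- Starting in `D` and iterating `β ∘ h` one eventually leaves `D`. -/
def Flows (D : Finset V) (β h : V → V) : Prop :=
  ∃ ρ : V → ℕ, ∀ v ∈ D, ρ (β (h v)) < ρ v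

/-- Redirects to `c` everything that `β` sends to `d`. -/
noncomputable def redirect (β : V → V) (d c : V) : V → V :=
  fun v => if β v = d then c else β v

theorem flows_insert {D : Finset V} {d : V} (β h : V → V) :
    Flows (insert d D) β h ↔ β (h d) ≠ d ∧ Flows D (redirect β d (β (h d))) h := by
  constructor
  · rintro ⟨ρ, hρ⟩
    have h0 := hρ d (Finset.mem_insert_self _ _)
    refine ⟨fun h1 => by rw [h1] at h0; exact lt_irrefl _ h0, ρ, fun v hv => ?_⟩
    have h1 := hρ v (Finset.mem_insert_of_mem hv)
    unfold redirect
    split_ifs with h2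
    · rw [h2] at h1; exact h0.trans h1
    · exact h1
  · rintro ⟨hne, ρ, hρ⟩
    refine ⟨fun v => if v = d then 2 * ρ (β (h d)) + 1 else 2 * ρ v, fun v hv => ?_⟩
    by_cases hvd : v = d
    · subst hvd; simp [hne]
    · have h1 := hρ v ((Finset.mem_insert.1 hv).resolve_left hvd)
      unfold redirect at h1
      by_cases h2 : β (h v) = d
      · simp only [h2, if_true, hvd, if_false] at h1 ⊢; omega
      · simp only [h2, if_false, hvd] at h1 ⊢; omega

/-- `f` is the parent function of a tree rooted at `r`. -/
def IsParentFun (f : V → V) (r : V) : Prop :=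
  f r = r ∧ ∃ ρ : V → ℕ, ∀ v, v ≠ r → ρ (f v) < ρ v

/-- The edges from the vertices of `X` to their parents form a maximal matching
of the tree with parent function `f`, and the root `r` is matched to a vertex of `X`. -/
def IsLowerEnds (f : V → V) (X : Finset V) (r : V) : Prop :=
  Set.InjOn f X ∧ (∀ x ∈ X, f x ∉ X) ∧ r ∈ X.image f ∧
    ∀ u, u ∉ X ∪ X.image f → f u ∈ X ∪ X.image f

/-- The function that agrees with `f` on `X` and is the identity elsewhere. -/
noncomputable def idOff (X : Finset V) (f : V → V) : V → V := fun v => if v ∈ X then f v else v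

theorem flows_idOff {f : V → V} {X D : Finset V} (hX : ∀ x ∈ X, f x ∉ X) (hXD : X ⊆ D) :
    Flows D id f ↔ Flows (D \ X) (idOff X f) f := by
  constructor
  · rintro ⟨ρ, hρ⟩
    refine ⟨ρ, fun v hv => ?_⟩
    rw [Finset.mem_sdiff] at hv
    have := hρ v hv.1
    unfold idOff
    split_ifs with h
    · exact (hρ _ (hXD h)).trans this
    · exact this
  · rintro ⟨ρ, hρ⟩
    refine ⟨fun w => 2 * ρ (idOff X f w) + if w ∈ X then 1 else 0, fun v hv => ?_⟩
    by_cases hvX : v ∈ X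
    · have := hX v hvX
      simp [idOff, hvX, this]
    · have := hρ v (Finset.mem_sdiff.2 ⟨hv, hvX⟩)
      have h2 : idOff X f v = v := by simp [idOff, hvX]
      simp only [h2, hvX, if_false, id]
      split_ifs <;> omega

variable [Fintype V]

/-- The number of choice functions of the family `L` that flow out of `D`. -/
noncomputable def flowCount (D : Finset V) (β : V → V) (L : V → Finset V) : ℕ :=
  ((Fintype.piFinset L).filter (Flows D β)).card

theorem flowCount_insert {D : Finset V} {d : V} (β : V → V) (L : V → Finset V) :
    flowCount (insert d D) β L = ∑ v ∈ (L d).filter (fun v => β v ≠ d),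
      flowCount D (redirect β d (β v)) (Function.update L d {v}) := by
  unfold flowCount
  rw [Finset.card_eq_sum_card_fiberwise (f := fun h : V → V => h d)
    (t := (L d).filter (fun v => β v ≠ d))]
  · refine Finset.sum_congr rfl fun v hv => ?_
    congr 1
    ext h
    simp only [Finset.mem_filter, Fintype.mem_piFinset, flows_insert]
    rw [Finset.mem_filter] at hv
    constructor
    · rintro ⟨⟨h1, h2, h3⟩, rfl⟩
      refine ⟨fun w => ?_, h3⟩
      by_cases hw : w = d
      · subst hw; simp
      · simp [hw, h1 w]
    · rintro ⟨h1, h3⟩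
      have hd : h d = v := by simpa using h1 d
      subst hd
      refine ⟨⟨fun w => ?_, hv.2, h3⟩, rfl⟩
      by_cases hw : w = d
      · subst hw; exact hv.1
      · simpa [hw] using h1 w
  · intro h hh
    simp only [Finset.coe_filter, Set.mem_ofPred_eq, Fintype.mem_piFinset, flows_insert] at hh ⊢
    exact ⟨hh.1 d, hh.2.1⟩

theorem flowCount_uniform (D : Finset V) : ∀ (β : V → V) (L : V → Finset V),
    (∀ d ∈ D, L d = Finset.univ) → (∀ d ∉ D, (L d).card = 1) →
    flowCount D β L * Fintype.card V
      = (Finset.univ.filter fun v => β v ∉ D).card * Fintype.card V ^ D.card := by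
  induction D using Finset.induction_on with
  | empty =>
    intro β L _ h1
    have : (Fintype.piFinset L).filter (Flows ∅ β) = Fintype.piFinset L :=
      Finset.filter_true_of_mem fun h _ => ⟨fun _ => 0, by simp⟩
    rw [flowCount, this, Fintype.card_piFinset, Finset.prod_congr rfl fun d _ => h1 d (by simp)]
    simp
  | insert d D hd ih =>
    intro β L h0 h1
    rw [flowCount_insert, h0 d (Finset.mem_insert_self _ _), Finset.sum_mul]
    set y := (Finset.univ.filter fun v => β v ∉ insert d D).card with hy
    set z := (Finset.univ.filter fun v => β v = d).card with hz
    have key : ∀ v ∈ Finset.univ.filter (fun v => β v ≠ d),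
        flowCount D (redirect β d (β v)) (Function.update L d {v}) * Fintype.card V
          = (y + if β v ∉ D then z else 0) * Fintype.card V ^ D.card := by
      intro v hv
      rw [ih]
      · congr 1
        have hsplit : (Finset.univ.filter fun w => redirect β d (β v) w ∉ D)
            = (Finset.univ.filter fun w => β w ∉ insert d D) ∪
              (Finset.univ.filter fun w => β w = d ∧ β v ∉ D) := by
          ext w
          simp only [Finset.mem_filter, Finset.mem_univ, true_and, Finset.mem_union,
            Finset.mem_insert]
          unfold redirect
          by_cases hw : β w = d <;> simp [hw]
        rw [hsplit, Finset.card_union_of_disjoint]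
        · congr 1
          split_ifs with hvD <;> simp [hvD, hz]
        · rw [Finset.disjoint_filter]
          rintro w - hw ⟨hw', -⟩
          exact hw (by simp [hw'])
      · intro w hw
        have : w ≠ d := fun h => hd (h ▸ hw)
        rw [Function.update_of_ne this]
        exact h0 w (Finset.mem_insert_of_mem hw)
      · intro w hw
        by_cases hwd : w = d
        · subst hwd; simp
        · rw [Function.update_of_ne hwd]
          exact h1 w (by simp [hwd, hw])
    rw [Finset.sum_congr rfl key, ← Finset.sum_mul, Finset.card_insert_of_notMem hd, pow_succ']
    have hs : ∑ v ∈ Finset.univ.filter (fun v => β v ≠ d), (y + if β v ∉ D then z else 0)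
        = Fintype.card V * y := by
      rw [Finset.sum_add_distrib, ← Finset.sum_filter, Finset.filter_filter, Finset.sum_const,
        Finset.sum_const]
      have e1 : (Finset.univ.filter fun v => β v ≠ d ∧ β v ∉ D).card = y := by
        rw [hy]; congr 1; ext v; simp
      have e2 : z + (Finset.univ.filter fun v => β v ≠ d).card = Fintype.card V := by
        rw [hz]
        exact Finset.card_filter_add_card_filter_not (s := (Finset.univ : Finset V)) _
      rw [e1, ← e2]; simp only [smul_eq_mul]; ring
    rw [hs]; ring

theorem sum_flowCount (Y Z : Finset V) (hY : Y.Nonempty) (U : Finset V) :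
    ∀ (β : V → V) (L : V → Finset V), Disjoint U Y →
    (∀ d ∈ U, L d = Z) → (∀ d ∈ Y, L d = Finset.univ) → (∀ d ∉ U, d ∉ Y → (L d).card = 1) →
    (∀ z ∈ Z, β z ∈ Y) → (∀ v ∉ U, β v ∈ Y) → (∀ u ∈ U, β u = u) →
    ∑ r ∈ Y, flowCount (U ∪ Y.erase r) β (Function.update L r {r})
      = Z.card ^ U.card * Fintype.card V ^ (Y.card - 1) := by
  induction U using Finset.induction_on with
  | empty =>
    intro β L _ _ h1 h2 _ hβ _
    have hn : 0 < Fintype.card V := Fintype.card_pos_iff.2 ⟨hY.choose⟩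
    refine Nat.eq_of_mul_eq_mul_right hn ?_
    rw [Finset.sum_mul]
    have key : ∀ r ∈ Y, flowCount (∅ ∪ Y.erase r) β (Function.update L r {r}) * Fintype.card V
        = (Finset.univ.filter fun v => β v = r).card * Fintype.card V ^ (Y.card - 1) := by
      intro r hr
      rw [Finset.empty_union, flowCount_uniform, Finset.card_erase_of_mem hr]
      · congr 2
        ext v
        have := hβ v (by simp)
        simp [this]
      · intro d hd
        rw [Finset.mem_erase] at hd
        rw [Function.update_of_ne hd.1, h1 d hd.2]
      · intro d hd
        by_cases hdr : d = r
        · subst hdr; simp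
        · rw [Function.update_of_ne hdr]
          exact h2 d (by simp) (fun h => hd (Finset.mem_erase.2 ⟨hdr, h⟩))
    rw [Finset.sum_congr rfl key, ← Finset.sum_mul,
      ← Finset.card_eq_sum_card_fiberwise (s := Finset.univ) fun v _ => hβ v (by simp)]
    simp [mul_comm]
  | insert d U hd ih =>
    intro β L hdis h0 h1 h2 hZ hβ hU
    rw [Finset.disjoint_insert_left] at hdis
    have key : ∀ r ∈ Y, flowCount (insert d U ∪ Y.erase r) β (Function.update L r {r})
        = ∑ v ∈ Z, flowCount (U ∪ Y.erase r) (redirect β d (β v))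
            (Function.update (Function.update L d {v}) r {r}) := by
      intro r hr
      have hdr : d ≠ r := fun h => hdis.1 (h ▸ hr)
      rw [Finset.insert_union, flowCount_insert, Function.update_of_ne hdr,
        h0 d (Finset.mem_insert_self _ _), Finset.filter_true_of_mem]
      · refine Finset.sum_congr rfl fun v _ => ?_
        rw [Function.update_comm hdr]
      · intro v hv h
        exact hdis.1 (h ▸ hZ v hv)
    rw [Finset.sum_congr rfl key, Finset.sum_comm]
    rw [Finset.card_insert_of_notMem hd, pow_succ']
    rw [Finset.sum_congr rfl fun v hv => ih (redirect β d (β v)) (Function.update L d {v})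
      hdis.2 ?_ ?_ ?_ ?_ ?_ ?_]
    · rw [Finset.sum_const, smul_eq_mul, mul_assoc]
    · intro u hu
      rw [Function.update_of_ne (fun h : u = d => hd (h ▸ hu))]
      exact h0 u (Finset.mem_insert_of_mem hu)
    · intro u hu
      rw [Function.update_of_ne (fun h : u = d => hdis.1 (h ▸ hu))]
      exact h1 u hu
    · intro u hu hu'
      by_cases hud : u = d
      · subst hud; simp
      · rw [Function.update_of_ne hud]
        exact h2 u (by simp [hud, hu]) hu'
    · intro z hz
      unfold redirect
      split_ifs
      exacts [hZ v hv, hZ z hz]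
    · intro w hw
      unfold redirect
      split_ifs with h
      · exact hZ v hv
      · by_cases hwd : w = d
        · subst hwd; exact absurd (hU w (Finset.mem_insert_self _ _)) h
        · exact hβ w (by simp [hwd, hw])
    · intro u hu
      have := hU u (Finset.mem_insert_of_mem hu)
      unfold redirect
      rw [this, if_neg (fun h : u = d => hd (h ▸ hu))]

theorem card_idOff (X : Finset V) :
    (Finset.univ.filter fun e : V → V => (∀ v ∉ X, e v = v) ∧ Set.InjOn e X ∧ ∀ x ∈ X, e x ∉ X).card
      = (Fintype.card V - X.card).descFactorial X.card := by
  have h : Fintype.card (↥X ↪ ↥(Xᶜ)) = (Fintype.card V - X.card).descFactorial X.card := by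
    rw [Fintype.card_embedding_eq, Fintype.card_coe, Fintype.card_coe, Finset.card_compl]
  rw [← h, ← Finset.card_univ]
  symm
  refine Finset.card_bij (fun g _ v => if hv : v ∈ X then (g ⟨v, hv⟩ : V) else v) ?_ ?_ ?_
  · intro g _
    simp only [Finset.mem_filter, Finset.mem_univ, true_and]
    refine ⟨fun v hv => by simp [hv], ?_, ?_⟩
    · intro a ha b hb hab
      rw [Finset.mem_coe] at ha hb
      simp only [ha, hb, dif_pos] at hab
      simpa using g.injective (Subtype.ext hab)
    · intro x hx
      simp only [hx, dif_pos]
      exact Finset.mem_compl.1 (g ⟨x, hx⟩).2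
  · intro g _ g' _ hgg
    ext ⟨x, hx⟩
    have := congrFun hgg x
    simpa [hx] using this
  · intro e he
    simp only [Finset.mem_filter, Finset.mem_univ, true_and] at he
    obtain ⟨h1, h2, h3⟩ := he
    refine ⟨⟨fun x => ⟨e x, Finset.mem_compl.2 (h3 x x.2)⟩, fun a b hab => ?_⟩,
      Finset.mem_univ _, ?_⟩
    · exact Subtype.ext (h2 a.2 b.2 (congrArg Subtype.val hab))
    · funext v
      by_cases hv : v ∈ X
      · simp only [hv, dif_pos]; rfl
      · simp [hv, h1 v hv]

theorem card_parentFun_of_idOff {X : Finset V} (hX : X.Nonempty) {e : V → V}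
    (he : ∀ v ∉ X, e v = v) (hinj : Set.InjOn e X) (hne : ∀ x ∈ X, e x ∉ X) :
    (Finset.univ.filter fun p : (V → V) × V =>
      (IsParentFun p.1 p.2 ∧ IsLowerEnds p.1 X p.2) ∧ idOff X p.1 = e).card
      = (2 * X.card) ^ (Fintype.card V - 2 * X.card) * Fintype.card V ^ (X.card - 1) := by
  set Y := X.image e with hY
  have hYc : Y.card = X.card := Finset.card_image_of_injOn hinj
  have hXY : Disjoint X Y := by
    rw [Finset.disjoint_right]
    intro y hy
    obtain ⟨x, hx, rfl⟩ := Finset.mem_image.1 hy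
    exact hne x hx
  set Z := X ∪ Y with hZ
  have hZc : Z.card = 2 * X.card := by rw [hZ, Finset.card_union_of_disjoint hXY, hYc]; ring
  set U := Zᶜ with hU
  have hUc : U.card = Fintype.card V - 2 * X.card := by rw [hU, Finset.card_compl, hZc]
  have hUY : Disjoint U Y := by
    rw [Finset.disjoint_left]; intro u hu hy
    exact Finset.mem_compl.1 hu (Finset.mem_union_right _ hy)
  have hUX : ∀ u ∈ U, u ∉ X := fun u hu hx => Finset.mem_compl.1 hu (Finset.mem_union_left _ hx)
  have hYX : ∀ y ∈ Y, y ∉ X := fun y hy hx => (Finset.disjoint_left.1 hXY) hx hy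
  set L : V → Finset V := fun v => if v ∈ X then {e v} else if v ∈ Y then Finset.univ else Z
    with hL
  have hmain := sum_flowCount Y Z (hX.image e) U e L hUY ?_ ?_ ?_ ?_ ?_ ?_
  · rw [hZc, hUc, hYc] at hmain
    rw [← hmain, Finset.card_eq_sum_card_fiberwise (f := Prod.snd) (t := Y)]
    · refine Finset.sum_congr rfl fun r hr => ?_
      have hrX : r ∉ X := hYX r hr
      refine Finset.card_bij (fun p _ => p.1) ?_ ?_ ?_
      · rintro ⟨f, r'⟩ hp
        simp only [Finset.mem_filter, Finset.mem_univ, true_and] at hp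
        obtain ⟨⟨⟨⟨hfr, hρ⟩, -, -, -, hlow⟩, hid⟩, rfl⟩ := hp
        have hfe : ∀ x ∈ X, f x = e x := fun x hx => by rw [← hid]; simp [idOff, hx]
        have him : X.image f = Y := Finset.image_congr fun x hx => hfe x hx
        rw [him] at hlow
        rw [Finset.mem_filter, Fintype.mem_piFinset]
        constructor
        · intro v
          by_cases hv : v = r'
          · subst hv; simp [hfr]
          · rw [Function.update_of_ne hv]
            simp only [hL]
            split_ifs with h1 h2
            · simp [hfe v h1]
            · simp
            · exact hlow v (by simp [h1, h2])
        · have := (flows_idOff (f := f) (X := X) (D := Finset.univ.erase r')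
            (fun x hx => by rw [hfe x hx]; exact hne x hx)
            (fun x hx => Finset.mem_erase.2 ⟨fun h => hrX (h ▸ hx), Finset.mem_univ _⟩)).1
            (by obtain ⟨ρ, hρ⟩ := hρ
                exact ⟨ρ, fun v hv => hρ v (Finset.ne_of_mem_erase hv)⟩)
          rw [hid] at this
          obtain ⟨ρ, hρ⟩ := this
          refine ⟨ρ, fun v hv => hρ v ?_⟩
          rw [Finset.mem_union] at hv
          rw [Finset.mem_sdiff, Finset.mem_erase]
          rcases hv with hv | hv
          · exact ⟨⟨fun h => (Finset.disjoint_left.1 hUY) hv (h ▸ hr), Finset.mem_univ _⟩,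
              hUX v hv⟩
          · rw [Finset.mem_erase] at hv
            exact ⟨⟨hv.1, Finset.mem_univ _⟩, hYX v hv.2⟩
      · rintro ⟨f, r'⟩ hp ⟨g, r''⟩ hq hfg
        simp only [Finset.mem_filter] at hp hq
        exact Prod.ext hfg (hp.2.trans hq.2.symm)
      · intro f hf
        rw [Finset.mem_filter, Fintype.mem_piFinset] at hf
        obtain ⟨hf, hflow⟩ := hf
        have hfr : f r = r := by simpa using hf r
        have hf' : ∀ v, v ≠ r → f v ∈ L v := fun v hv => by
          have := hf v; rwa [Function.update_of_ne hv] at this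
        have hfe : ∀ x ∈ X, f x = e x := fun x hx => by
          have := hf' x (fun h => hrX (h ▸ hx))
          simpa [hL, hx] using this
        have hid : idOff X f = e := by
          funext v
          by_cases hv : v ∈ X
          · simp [idOff, hv, hfe v hv]
          · simp [idOff, hv, he v hv]
        have him : X.image f = Y := Finset.image_congr fun x hx => hfe x hx
        refine ⟨(f, r), ?_, rfl⟩
        simp only [Finset.mem_filter, Finset.mem_univ, true_and, and_true]
        refine ⟨⟨⟨hfr, ?_⟩, ?_, ?_, ?_, ?_⟩, hid⟩
        · have := (flows_idOff (f := f) (X := X) (D := Finset.univ.erase r)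
            (fun x hx => by rw [hfe x hx]; exact hne x hx)
            (fun x hx => Finset.mem_erase.2 ⟨fun h => hrX (h ▸ hx), Finset.mem_univ _⟩)).2 ?_
          · obtain ⟨ρ, hρ⟩ := this
            exact ⟨ρ, fun v hv => hρ v (Finset.mem_erase.2 ⟨hv, Finset.mem_univ _⟩)⟩
          · rw [hid]
            obtain ⟨ρ, hρ⟩ := hflow
            refine ⟨ρ, fun v hv => hρ v ?_⟩
            rw [Finset.mem_sdiff, Finset.mem_erase] at hv
            rw [Finset.mem_union, Finset.mem_erase, hU, Finset.mem_compl, hZ, Finset.mem_union]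
            tauto
        · intro a ha b hb hab
          rw [hfe a ha, hfe b hb] at hab
          exact hinj ha hb hab
        · intro x hx; rw [hfe x hx]; exact hne x hx
        · rw [him]; exact hr
        · intro u hu
          rw [him] at hu ⊢
          rw [Finset.mem_union, not_or] at hu
          have := hf' u (fun h => hu.2 (h ▸ hr))
          simpa only [hL, hu.1, hu.2, if_false] using this
    · rintro ⟨f, r⟩ hp
      simp only [Finset.coe_filter, Finset.mem_univ, true_and, Set.mem_ofPred_eq] at hp
      obtain ⟨⟨-, -, -, hr, -⟩, hid⟩ := hp
      have him : X.image f = Y := Finset.image_congr fun x hx => by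
        rw [← hid]; simp [idOff, Finset.mem_coe.1 hx]
      rw [← him]; exact hr
  · intro u hu
    have h1 := hUX u hu
    have h2 := (Finset.disjoint_left.1 hUY) hu
    simp [hL, h1, h2]
  · intro y hy
    have h1 := hYX y hy
    simp [hL, h1, hy]
  · intro v hv hvY
    have : v ∈ X := by
      by_contra h
      exact hv (Finset.mem_compl.2 (by simp [hZ, h, hvY]))
    simp [hL, this]
  · intro z hz
    rcases Finset.mem_union.1 hz with h | h
    · exact Finset.mem_image_of_mem _ h
    · rw [he z (hYX z h)]; exact h
  · intro v hv
    have hz : v ∈ Z := by simpa [hU] using hv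
    rcases Finset.mem_union.1 hz with h | h
    · exact Finset.mem_image_of_mem _ h
    · rw [he v (hYX v h)]; exact h
  · intro u hu
    exact he u (hUX u hu)

theorem card_parentFun_lowerEnds {k : ℕ} (hk : 1 ≤ k) :
    (Finset.univ.filter fun p : Finset V × (V → V) × V =>
      p.1.card = k ∧ IsParentFun p.2.1 p.2.2 ∧ IsLowerEnds p.2.1 p.1 p.2.2).card
      = (Fintype.card V).choose k * (Fintype.card V - k).descFactorial k *
        ((2 * k) ^ (Fintype.card V - 2 * k) * Fintype.card V ^ (k - 1)) := by
  rw [Finset.card_eq_sum_card_fiberwise (f := Prod.fst)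
    (t := (Finset.univ : Finset V).powersetCard k)]
  · have key : ∀ X ∈ (Finset.univ : Finset V).powersetCard k,
        ((Finset.univ.filter fun p : Finset V × (V → V) × V =>
          p.1.card = k ∧ IsParentFun p.2.1 p.2.2 ∧ IsLowerEnds p.2.1 p.1 p.2.2).filter
            fun p => p.1 = X).card = (Fintype.card V - k).descFactorial k *
        ((2 * k) ^ (Fintype.card V - 2 * k) * Fintype.card V ^ (k - 1)) := by
      intro X hX
      obtain ⟨-, hXk⟩ := Finset.mem_powersetCard.1 hX
      have hXne : X.Nonempty := Finset.card_pos.1 (by omega)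
      have h1 : ((Finset.univ.filter fun p : Finset V × (V → V) × V =>
          p.1.card = k ∧ IsParentFun p.2.1 p.2.2 ∧ IsLowerEnds p.2.1 p.1 p.2.2).filter
            fun p => p.1 = X).card = (Finset.univ.filter fun p : (V → V) × V =>
              IsParentFun p.1 p.2 ∧ IsLowerEnds p.1 X p.2).card := by
        refine Finset.card_bij (fun p _ => p.2) ?_ ?_ ?_
        · rintro ⟨X', p⟩ hp
          simp only [Finset.mem_filter, Finset.mem_univ, true_and] at hp ⊢
          obtain ⟨⟨-, h⟩, rfl⟩ := hp
          exact h
        · rintro ⟨X', p⟩ hp ⟨X'', q⟩ hq hpq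
          simp only [Finset.mem_filter] at hp hq
          exact Prod.ext (hp.2.trans hq.2.symm) hpq
        · intro p hp
          simp only [Finset.mem_filter, Finset.mem_univ, true_and] at hp
          exact ⟨(X, p), by simpa [hXk] using hp, rfl⟩
      rw [h1, ← hXk, ← card_idOff X, Finset.card_eq_sum_card_fiberwise
        (f := fun p : (V → V) × V => idOff X p.1) (t := Finset.univ.filter fun e : V → V =>
          (∀ v ∉ X, e v = v) ∧ Set.InjOn e X ∧ ∀ x ∈ X, e x ∉ X)]
      · rw [Finset.sum_congr rfl, Finset.sum_const, smul_eq_mul]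
        intro e he
        simp only [Finset.mem_filter, Finset.mem_univ, true_and] at he
        rw [Finset.filter_filter]
        exact card_parentFun_of_idOff hXne he.1 he.2.1 he.2.2
      · rintro ⟨f, r⟩ hp
        simp only [Finset.coe_filter, Finset.mem_univ, true_and, Set.mem_ofPred_eq] at hp ⊢
        obtain ⟨-, hinj, hne, -⟩ := hp
        have hfe : ∀ x ∈ X, idOff X f x = f x := fun x hx => by simp [idOff, hx]
        refine ⟨fun v hv => by simp [idOff, hv], ?_, fun x hx => by rw [hfe x hx]; exact hne x hx⟩
        intro a ha b hb hab
        rw [hfe a ha, hfe b hb] at hab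
        exact hinj ha hb hab
    rw [Finset.sum_congr rfl key, Finset.sum_const, smul_eq_mul, Finset.card_powersetCard,
      Finset.card_univ, mul_assoc]
  · rintro ⟨X, p⟩ hp
    simp only [Finset.coe_filter, Finset.mem_univ, true_and, Set.mem_ofPred_eq] at hp
    simp [Finset.mem_powersetCard, hp.1]

end FunctionCount

section ParentGraph

variable {V : Type*}

/-- The graph joining every vertex to its image under `f`. -/
def parentGraph (f : V → V) : SimpleGraph V := SimpleGraph.fromRel fun a b => f a = b

theorem parentGraph_adj {f : V → V} {a b : V} :
    (parentGraph f).Adj a b ↔ a ≠ b ∧ (f a = b ∨ f b = a) :=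
  SimpleGraph.fromRel_adj _ _ _

theorem IsParentFun.apply_ne {f : V → V} {r v : V} (h : IsParentFun f r) (hv : v ≠ r) :
    f v ≠ v := by
  obtain ⟨-, ρ, hρ⟩ := h
  intro h1
  have := hρ v hv
  rw [h1] at this
  exact lt_irrefl _ this

theorem IsParentFun.eq_root_of_apply_apply {f : V → V} {r v : V} (h : IsParentFun f r)
    (hv : f (f v) = v) : v = r := by
  by_contra hne
  obtain ⟨hr, ρ, hρ⟩ := h
  have h1 := hρ v hne
  by_cases h2 : f v = r
  · rw [h2, hr] at hv; exact hne hv.symm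
  · have h3 := hρ _ h2
    rw [hv] at h3
    exact lt_asymm h1 h3

theorem IsParentFun.adj {f : V → V} {r v : V} (h : IsParentFun f r) (hv : v ≠ r) :
    (parentGraph f).Adj v (f v) :=
  parentGraph_adj.2 ⟨(h.apply_ne hv).symm, Or.inl rfl⟩

theorem IsParentFun.connected {f : V → V} {r : V} (h : IsParentFun f r) :
    (parentGraph f).Connected := by
  have hreach : ∀ v, (parentGraph f).Reachable v r := by
    obtain ⟨-, ρ, hρ⟩ := id h
    intro v
    induction hn : ρ v using Nat.strong_induction_on generalizing v with
    | _ n ih =>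
      by_cases hv : v = r
      · rw [hv]
      · exact (h.adj hv).reachable.trans (ih _ (hn ▸ hρ v hv) _ rfl)
  have : Nonempty V := ⟨r⟩
  exact ⟨fun a b => (hreach a).trans (hreach b).symm⟩

theorem IsParentFun.isTree [Finite V] {f : V → V} {r : V} (h : IsParentFun f r) :
    (parentGraph f).IsTree := by
  classical
  have := Fintype.ofFinite V
  refine SimpleGraph.isTree_iff_connected_and_card.2 ⟨h.connected, le_antisymm ?_
    h.connected.card_vert_le_card_edgeSet_add_one⟩
  have hsub : (parentGraph f).edgeSet ⊆
      (((Finset.univ.erase r).image fun v => s(v, f v) : Finset (Sym2 V)) : Set (Sym2 V)) := by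
    intro e
    induction e using Sym2.ind with
    | _ a b =>
      intro hab
      obtain ⟨hne, h1⟩ := parentGraph_adj.1 hab
      simp only [Finset.coe_image, Set.mem_image, Finset.mem_coe, Finset.mem_erase,
        Finset.mem_univ, and_true]
      rcases h1 with h1 | h1
      · exact ⟨a, fun h2 => hne (by rw [← h1, h2, h.1]), by rw [h1]⟩
      · exact ⟨b, fun h2 => hne (by rw [← h1, h2, h.1]), by rw [h1, Sym2.eq_swap]⟩
  have h1 : Nat.card (parentGraph f).edgeSet ≤ Fintype.card V - 1 := by
    rw [Nat.card_coe_set_eq]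
    refine (Set.ncard_le_ncard hsub (Finset.finite_toSet _)).trans ?_
    rw [Set.ncard_coe_finset]
    refine Finset.card_image_le.trans ?_
    rw [Finset.card_erase_of_mem (Finset.mem_univ _), Finset.card_univ]
  have : 0 < Fintype.card V := Fintype.card_pos_iff.2 ⟨r⟩
  rw [Nat.card_eq_fintype_card (α := V)]
  omega

theorem SimpleGraph.IsTree.exists_parentFun [Finite V] {T : SimpleGraph V} (hT : T.IsTree)
    (r : V) : ∃ f, IsParentFun f r ∧ parentGraph f = T := by
  classical
  have hstep : ∀ v, v ≠ r → ∃ w, T.Adj v w ∧ T.dist w r < T.dist v r := by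
    intro v hv
    obtain ⟨p, hp⟩ := hT.connected.exists_walk_length_eq_dist v r
    cases p with
    | nil => exact absurd rfl hv
    | cons hadj q =>
      refine ⟨_, hadj, ?_⟩
      have := SimpleGraph.dist_le q
      rw [SimpleGraph.Walk.length_cons] at hp
      omega
  choose! g hg using hstep
  have hf : IsParentFun (fun v => if v = r then r else g v) r :=
    ⟨if_pos rfl, fun v => T.dist v r, fun v hv => by simpa [hv] using (hg v hv).2⟩
  refine ⟨_, hf, ?_⟩
  have hle : parentGraph (fun v => if v = r then r else g v) ≤ T := by
    intro a b hab
    obtain ⟨hne, h1 | h1⟩ := parentGraph_adj.1 hab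
    · by_cases ha : a = r
      · simp only [ha, if_true] at h1; exact absurd (ha.trans h1) hne
      · simp only [ha, if_false] at h1; exact h1 ▸ (hg a ha).1
    · by_cases hb : b = r
      · simp only [hb, if_true] at h1; exact absurd (h1.symm.trans hb.symm) hne
      · simp only [hb, if_false] at h1; exact h1 ▸ (hg b hb).1.symm
  exact le_antisymm hle ((SimpleGraph.isTree_iff_minimal_connected.1 hT).2 hf.connected hle)

theorem IsParentFun.unique {f g : V → V} {r : V} (hf : IsParentFun f r) (hg : IsParentFun g r)
    (h : parentGraph f = parentGraph g) : f = g := by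
  obtain ⟨ρ, hρ⟩ := hf.2
  funext v
  induction hn : ρ v using Nat.strong_induction_on generalizing v with
  | _ n ih =>
    by_cases hv : v = r
    · rw [hv, hf.1, hg.1]
    · have h1 := hf.adj hv
      rw [h, parentGraph_adj] at h1
      rcases h1.2 with h2 | h2
      · exact h2.symm
      · have h3 := ih _ (hn ▸ hρ v hv) _ rfl
        rw [h2] at h3
        exact absurd (hf.eq_root_of_apply_apply h3) hv

end ParentGraph

section MatchedForest

open scoped Classical

variable {V : Type*}

/-- `F` is a forest and `H` is the graph formed by the edges of a maximal matching of `F`. -/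
structure IsMatchedForest (F H : SimpleGraph V) : Prop where
  isAcyclic : F.IsAcyclic
  le : H ≤ F
  unique : ∀ ⦃a b c⦄, H.Adj a b → H.Adj a c → b = c
  covers : ∀ ⦃a b⦄, F.Adj a b → a ∈ H.support ∨ b ∈ H.support

/-- The graph joining every vertex of `X` to its image under `f`. -/
def pairGraph (f : V → V) (X : Finset V) : SimpleGraph V :=
  SimpleGraph.fromRel fun a b => a ∈ X ∧ f a = b

theorem pairGraph_adj {f : V → V} {X : Finset V} {a b : V} :
    (pairGraph f X).Adj a b ↔ a ≠ b ∧ (a ∈ X ∧ f a = b ∨ b ∈ X ∧ f b = a) :=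
  SimpleGraph.fromRel_adj _ _ _

theorem support_pairGraph {f : V → V} {X : Finset V} (h : ∀ x ∈ X, f x ∉ X) :
    (pairGraph f X).support = (X ∪ X.image f : Finset V) := by
  ext v
  simp only [SimpleGraph.mem_support, pairGraph_adj, Finset.coe_union, Set.mem_union,
    Finset.mem_coe, Finset.mem_image]
  constructor
  · rintro ⟨w, -, h1 | h1⟩
    · exact Or.inl h1.1
    · exact Or.inr ⟨w, h1⟩
  · rintro (h1 | ⟨w, h1, rfl⟩)
    · exact ⟨f v, fun h2 => h v h1 (h2 ▸ h1), Or.inl ⟨h1, rfl⟩⟩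
    · exact ⟨w, fun h2 => h w h1 (by rwa [h2]), Or.inr ⟨h1, rfl⟩⟩

theorem IsLowerEnds.root_notMem {f : V → V} {X : Finset V} {r : V} (hf : IsParentFun f r)
    (hX : IsLowerEnds f X r) : r ∉ X :=
  fun h => hX.2.1 r h (hf.1.symm ▸ h)

theorem IsLowerEnds.isMatchedForest [Finite V] {f : V → V} {X : Finset V} {r : V}
    (hf : IsParentFun f r) (hX : IsLowerEnds f X r) :
    IsMatchedForest (parentGraph f) (pairGraph f X) where
  isAcyclic := hf.isTree.isAcyclic
  le a b h := by
    rw [pairGraph_adj] at h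
    rw [parentGraph_adj]
    tauto
  unique a b c hb hc := by
    obtain ⟨-, h1 | h1⟩ := pairGraph_adj.1 hb <;> obtain ⟨-, h2 | h2⟩ := pairGraph_adj.1 hc
    · exact h1.2.symm.trans h2.2
    · exact absurd (h2.2.symm ▸ h1.1) (hX.2.1 c h2.1)
    · exact absurd (h1.2.symm ▸ h2.1) (hX.2.1 b h1.1)
    · exact hX.1 h1.1 h2.1 (h1.2.trans h2.2.symm)
  covers a b h := by
    rw [support_pairGraph hX.2.1]
    simp only [Finset.mem_coe]
    by_contra! h1
    obtain ⟨-, rfl | rfl⟩ := parentGraph_adj.1 h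
    · exact h1.2 (hX.2.2.2 _ h1.1)
    · exact h1.1 (hX.2.2.2 _ h1.2)

theorem IsLowerEnds.mem_iff {f : V → V} {X : Finset V} {r x : V}
    (hf : IsParentFun f r) (hX : IsLowerEnds f X r) :
    x ∈ X ↔ x ≠ r ∧ (pairGraph f X).Adj x (f x) := by
  rw [pairGraph_adj]
  constructor
  · intro h
    exact ⟨fun h1 => hX.root_notMem hf (h1 ▸ h), fun h1 => hX.2.1 x h (h1 ▸ h), Or.inl ⟨h, rfl⟩⟩
  · rintro ⟨h1, -, h2 | h2⟩
    · exact h2.1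
    · exact absurd (hf.eq_root_of_apply_apply h2.2) h1

theorem card_support_pairGraph [Fintype V] {f : V → V} {X : Finset V} {r : V}
    (hX : IsLowerEnds f X r) :
    (Finset.univ.filter (· ∈ (pairGraph f X).support)).card = 2 * X.card := by
  have h1 : Finset.univ.filter (· ∈ (pairGraph f X).support) = X ∪ X.image f := by
    ext v
    rw [Finset.mem_filter_univ, support_pairGraph hX.2.1, Finset.mem_coe]
  rw [h1, Finset.card_union_of_disjoint, Finset.card_image_of_injOn hX.1, two_mul]
  rw [Finset.disjoint_right]
  intro v hv
  obtain ⟨x, hx, rfl⟩ := Finset.mem_image.1 hv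
  exact hX.2.1 x hx

theorem IsMatchedForest.exists_lowerEnds [Fintype V] {F H : SimpleGraph V}
    (h : IsMatchedForest F H) {f : V → V} {r : V} (hf : IsParentFun f r)
    (hF : parentGraph f = F) (hr : r ∈ H.support) :
    ∃ X, IsLowerEnds f X r ∧ pairGraph f X = H := by
  set X : Finset V := Finset.univ.filter fun x => x ≠ r ∧ H.Adj x (f x) with hXdef
  have hmem : ∀ x, x ∈ X ↔ x ≠ r ∧ H.Adj x (f x) := by simp [hXdef]
  have hpair : pairGraph f X = H := by
    ext a b
    rw [pairGraph_adj]
    constructor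
    · rintro ⟨-, ⟨h1, rfl⟩ | ⟨h1, rfl⟩⟩
      · exact ((hmem _).1 h1).2
      · exact ((hmem _).1 h1).2.symm
    · intro hab
      have h1 := h.le hab
      rw [← hF, parentGraph_adj] at h1
      obtain ⟨hne, rfl | rfl⟩ := h1
      · refine ⟨hne, Or.inl ⟨(hmem _).2 ⟨?_, hab⟩, rfl⟩⟩
        rintro rfl
        exact hne hf.1.symm
      · refine ⟨hne, Or.inr ⟨(hmem _).2 ⟨?_, hab.symm⟩, rfl⟩⟩
        rintro rfl
        exact hne hf.1
  have hlow : ∀ x ∈ X, f x ∉ X := by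
    intro x hx hfx
    have h1 := h.unique ((hmem _).1 hfx).2 ((hmem _).1 hx).2.symm
    exact ((hmem _).1 hx).1 (hf.eq_root_of_apply_apply h1)
  have hsupp : H.support = (X ∪ X.image f : Finset V) := by
    rw [← hpair, support_pairGraph hlow]
  refine ⟨X, ⟨?_, hlow, ?_, ?_⟩, hpair⟩
  · intro x hx y hy hxy
    have h1 := ((hmem _).1 hy).2.symm
    rw [← hxy] at h1
    exact h.unique ((hmem _).1 hx).2.symm h1
  · have h1 : r ∈ X ∪ X.image f := by rw [← Finset.mem_coe, ← hsupp]; exact hr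
    exact (Finset.mem_union.1 h1).resolve_left fun h2 => ((hmem _).1 h2).1 rfl
  · intro u hu
    rw [← Finset.mem_coe, ← hsupp] at hu ⊢
    have hur : u ≠ r := fun h1 => hu (h1 ▸ hr)
    exact (h.covers (hF ▸ hf.adj hur)).resolve_left hu

/-- Joins two vertices by an edge, and matches them if both are unmatched. -/
noncomputable def addEdge (p : SimpleGraph V × SimpleGraph V) (v w : V) :
    SimpleGraph V × SimpleGraph V :=
  (p.1 ⊔ SimpleGraph.edge v w,
    if v ∈ p.2.support ∨ w ∈ p.2.support then p.2 else p.2 ⊔ SimpleGraph.edge v w)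

theorem IsMatchedForest.addEdge {p : SimpleGraph V × SimpleGraph V}
    (h : IsMatchedForest p.1 p.2) {v w : V} (hvw : ¬ p.1.Reachable v w) :
    IsMatchedForest (addEdge p v w).1 (addEdge p v w).2 := by
  have hne : v ≠ w := by rintro rfl; exact hvw .rfl
  have hac : (p.1 ⊔ SimpleGraph.edge v w).IsAcyclic := h.isAcyclic.sup_edge_of_not_reachable hvw
  unfold _root_.addEdge
  split_ifs with hcov
  · refine ⟨hac, h.le.trans le_sup_left, h.unique, fun a b hab => ?_⟩
    rcases hab with hab | hab
    · exact h.covers hab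
    · rw [SimpleGraph.edge_adj] at hab
      obtain ⟨⟨rfl, rfl⟩ | ⟨rfl, rfl⟩, -⟩ := hab
      · exact hcov
      · exact hcov.symm
  · push Not at hcov
    have hv : ∀ x, ¬ p.2.Adj v x := fun x hx => hcov.1 (p.2.mem_support.2 ⟨x, hx⟩)
    have hw : ∀ x, ¬ p.2.Adj w x := fun x hx => hcov.2 (p.2.mem_support.2 ⟨x, hx⟩)
    refine ⟨hac, sup_le_sup_right h.le _, fun a b c hb hc => ?_, fun a b hab => ?_⟩
    · simp only [SimpleGraph.sup_adj, SimpleGraph.edge_adj] at hb hc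
      rcases hb with hb | ⟨⟨rfl, rfl⟩ | ⟨rfl, rfl⟩, -⟩ <;>
      rcases hc with hc | ⟨hc, -⟩
      · exact h.unique hb hc
      · rcases hc with ⟨rfl, rfl⟩ | ⟨rfl, rfl⟩
        · exact absurd hb (hv _)
        · exact absurd hb (hw _)
      · exact absurd hc (hv _)
      · rcases hc with ⟨_, rfl⟩ | ⟨rfl, rfl⟩ <;> rfl
      · exact absurd hc (hw _)
      · rcases hc with ⟨rfl, rfl⟩ | ⟨_, rfl⟩ <;> rfl
    · have hmono := SimpleGraph.support_mono (le_sup_left : p.2 ≤ p.2 ⊔ SimpleGraph.edge v w)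
      rcases hab with hab | hab
      · exact (h.covers hab).imp (fun h1 => hmono h1) fun h1 => hmono h1
      · exact Or.inl ((SimpleGraph.mem_support _).2 ⟨b, Or.inr hab⟩)

theorem addEdge_inj {p q : SimpleGraph V × SimpleGraph V} (hp : p.2 ≤ p.1) (hq : q.2 ≤ q.1)
    {v w : V} (hpvw : ¬ p.1.Adj v w) (hqvw : ¬ q.1.Adj v w)
    (h : addEdge p v w = addEdge q v w) : p = q := by
  have key : ∀ {G : SimpleGraph V}, ¬ G.Adj v w →
      (G ⊔ SimpleGraph.edge v w) \ SimpleGraph.edge v w = G := by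
    intro G hG
    rw [sup_sdiff_right_self, sdiff_eq_left, SimpleGraph.disjoint_left]
    intro a b hab h1
    rw [SimpleGraph.edge_adj] at h1
    obtain ⟨⟨rfl, rfl⟩ | ⟨rfl, rfl⟩, -⟩ := h1
    · exact hG hab
    · exact hG hab.symm
  have key2 : ∀ {G : SimpleGraph V}, ¬ G.Adj v w → G \ SimpleGraph.edge v w = G := by
    intro G hG
    conv_rhs => rw [← key hG]
    rw [sup_sdiff_right_self]
  have h1 : ∀ {r : SimpleGraph V × SimpleGraph V}, r.2 ≤ r.1 → ¬ r.1.Adj v w →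
      (addEdge r v w).1 \ SimpleGraph.edge v w = r.1 ∧
      (addEdge r v w).2 \ SimpleGraph.edge v w = r.2 := by
    intro r hr hrvw
    refine ⟨key hrvw, ?_⟩
    unfold addEdge
    split_ifs
    · exact key2 fun h2 => hrvw (hr h2)
    · exact key fun h2 => hrvw (hr h2)
  have h2 := h1 hp hpvw
  have h3 := h1 hq hqvw
  rw [h] at h2
  exact Prod.ext (h2.1.symm.trans h3.1) (h2.2.symm.trans h3.2)

theorem support_comap_subtype_iff {P : V → Prop} {H : SimpleGraph V}
    (hP : ∀ ⦃a b⦄, H.Adj a b → P a → P b) {x : Subtype P} :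
    x ∈ (H.comap (Subtype.val : Subtype P → V)).support ↔ (x : V) ∈ H.support := by
  rw [SimpleGraph.mem_support, SimpleGraph.mem_support]
  exact ⟨fun ⟨w, hw⟩ => ⟨w, hw⟩, fun ⟨w, hw⟩ => ⟨⟨w, hP hw x.2⟩, hw⟩⟩

theorem reachable_comap_subtype {P : V → Prop} {F : SimpleGraph V}
    (hP : ∀ ⦃a b⦄, F.Adj a b → P a → P b) {a b : V} (h : F.Reachable a b) (ha : P a) :
    ∃ hb : P b, (F.comap (Subtype.val : Subtype P → V)).Reachable ⟨a, ha⟩ ⟨b, hb⟩ := by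
  obtain ⟨w⟩ := h
  induction w with
  | nil => exact ⟨ha, .rfl⟩
  | cons hadj _ ih =>
    obtain ⟨hb, h1⟩ := ih (hP hadj ha)
    refine ⟨hb, SimpleGraph.Reachable.trans (SimpleGraph.Adj.reachable ?_) h1⟩
    exact hadj

theorem isBridge_of_comap_subtype {P : V → Prop} {F : SimpleGraph V}
    (hP : ∀ ⦃a b⦄, F.Adj a b → P a → P b)
    (hF : (F.comap (Subtype.val : Subtype P → V)).IsAcyclic) {a b : V} (hab : F.Adj a b)
    (ha : P a) : F.IsBridge s(a, b) := by
  rw [SimpleGraph.isBridge_iff]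
  intro h
  have h1 := (SimpleGraph.isAcyclic_iff_forall_adj_isBridge.1 hF)
    (show (F.comap (Subtype.val : Subtype P → V)).Adj ⟨a, ha⟩ ⟨b, hP hab ha⟩ from hab)
  rw [SimpleGraph.isBridge_iff] at h1
  obtain ⟨hb, h2⟩ := reachable_comap_subtype
    (fun x y hxy => hP (SimpleGraph.deleteEdges_le _ hxy)) h ha
  refine h1 (h2.mono fun x y hxy => ?_)
  rw [SimpleGraph.comap_adj, SimpleGraph.deleteEdges_adj] at hxy
  rw [SimpleGraph.deleteEdges_adj]
  refine ⟨hxy.1, fun h3 => hxy.2 ?_⟩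
  rw [Set.mem_singleton_iff] at h3 ⊢
  simpa using congrArg (Sym2.map Subtype.val) h3

/-- The restriction of a pair of graphs to the vertices satisfying `P`. -/
def restrictPair (P : V → Prop) (p : SimpleGraph V × SimpleGraph V) :
    SimpleGraph (Subtype P) × SimpleGraph (Subtype P) :=
  (p.1.comap Subtype.val, p.2.comap Subtype.val)

theorem IsMatchedForest.restrictPair {P : V → Prop} {p : SimpleGraph V × SimpleGraph V}
    (h : IsMatchedForest p.1 p.2) (hP : ∀ ⦃a b⦄, p.1.Adj a b → P a → P b) :
    IsMatchedForest (restrictPair P p).1 (restrictPair P p).2 where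
  isAcyclic := h.isAcyclic.comap (SimpleGraph.Hom.comap _ _) Subtype.val_injective
  le _ _ hab := h.le hab
  unique _ _ _ hb hc := Subtype.ext (h.unique hb hc)
  covers a b hab := by
    have h1 := fun x => support_comap_subtype_iff (H := p.2) (fun a b h2 => hP (h.le h2)) (x := x)
    exact (h.covers hab).imp (h1 a).2 (h1 b).2

theorem eq_of_comap_subtype (P : V → Prop) {F G : SimpleGraph V}
    (hF : ∀ ⦃a b⦄, F.Adj a b → (P a ↔ P b)) (hG : ∀ ⦃a b⦄, G.Adj a b → (P a ↔ P b))
    (h1 : F.comap (Subtype.val : {x // P x} → V) = G.comap Subtype.val)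
    (h2 : F.comap (Subtype.val : {x // ¬ P x} → V) = G.comap Subtype.val) : F = G := by
  have key : ∀ {a b}, (P a ↔ P b) → (F.Adj a b ↔ G.Adj a b) := by
    intro a b hab
    by_cases ha : P a
    · exact iff_of_eq (congrArg (fun K => K.Adj ⟨a, ha⟩ ⟨b, hab.1 ha⟩) h1)
    · exact iff_of_eq (congrArg (fun K => K.Adj ⟨a, ha⟩ ⟨b, mt hab.2 ha⟩) h2)
  ext a b
  exact ⟨fun h => (key (hF h)).1 h, fun h => (key (hG h)).2 h⟩

/-- The disjoint union of a graph on the vertices satisfying `P` and one on the others. -/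
def glueGraph (P : V → Prop) (G : SimpleGraph {x // P x}) (K : SimpleGraph {x // ¬ P x}) :
    SimpleGraph V where
  Adj a b := (∃ (ha : P a) (hb : P b), G.Adj ⟨a, ha⟩ ⟨b, hb⟩) ∨
    ∃ (ha : ¬ P a) (hb : ¬ P b), K.Adj ⟨a, ha⟩ ⟨b, hb⟩
  symm := ⟨fun _ _ h => h.imp (fun ⟨ha, hb, h⟩ => ⟨hb, ha, h.symm⟩)
    fun ⟨ha, hb, h⟩ => ⟨hb, ha, h.symm⟩⟩
  loopless := ⟨fun _ h => h.elim (fun ⟨_, _, h⟩ => h.ne rfl) fun ⟨_, _, h⟩ => h.ne rfl⟩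

section Glue

variable {P : V → Prop} {G : SimpleGraph {x // P x}} {K : SimpleGraph {x // ¬ P x}}

theorem glueGraph_closed {a b : V} (h : (glueGraph P G K).Adj a b) : P a ↔ P b := by
  rcases h with ⟨ha, hb, -⟩ | ⟨ha, hb, -⟩
  · exact iff_of_true ha hb
  · exact iff_of_false ha hb

theorem comap_glueGraph_left : (glueGraph P G K).comap Subtype.val = G := by
  ext a b
  exact ⟨fun h => h.elim (fun ⟨_, _, h⟩ => h) fun ⟨ha, _⟩ => absurd a.2 ha,
    fun h => Or.inl ⟨a.2, b.2, h⟩⟩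

theorem comap_glueGraph_right : (glueGraph P G K).comap Subtype.val = K := by
  ext a b
  exact ⟨fun h => h.elim (fun ⟨ha, _⟩ => absurd ha a.2) fun ⟨_, _, h⟩ => h,
    fun h => Or.inr ⟨a.2, b.2, h⟩⟩

theorem IsMatchedForest.glueGraph {G' : SimpleGraph {x // P x}} {K' : SimpleGraph {x // ¬ P x}}
    (hG : IsMatchedForest G G') (hK : IsMatchedForest K K') :
    IsMatchedForest (glueGraph P G K) (glueGraph P G' K') where
  isAcyclic := by
    rw [SimpleGraph.isAcyclic_iff_forall_adj_isBridge]
    intro a b hab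
    by_cases ha : P a
    · refine isBridge_of_comap_subtype (P := P) (fun a b h => (glueGraph_closed h).1) ?_ hab ha
      rw [comap_glueGraph_left]
      exact hG.isAcyclic
    · refine isBridge_of_comap_subtype (P := fun x => ¬ P x)
        (fun a b h => mt (glueGraph_closed h).2) ?_ hab ha
      rw [comap_glueGraph_right]
      exact hK.isAcyclic
  le _ _ h := h.imp (fun ⟨ha, hb, h⟩ => ⟨ha, hb, hG.le h⟩) fun ⟨ha, hb, h⟩ => ⟨ha, hb, hK.le h⟩
  unique a b c h1 h2 := by
    rcases h1 with ⟨ha, hb, h1⟩ | ⟨ha, hb, h1⟩ <;> rcases h2 with ⟨ha', hc, h2⟩ | ⟨ha', hc, h2⟩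
    · exact congrArg Subtype.val (hG.unique h1 h2)
    · exact absurd ha ha'
    · exact absurd ha' ha
    · exact congrArg Subtype.val (hK.unique h1 h2)
  covers a b h := by
    simp only [SimpleGraph.mem_support]
    rcases h with ⟨ha, hb, h⟩ | ⟨ha, hb, h⟩
    · exact (hG.covers h).imp (fun ⟨w, hw⟩ => ⟨w, Or.inl ⟨ha, w.2, hw⟩⟩)
        fun ⟨w, hw⟩ => ⟨w, Or.inl ⟨hb, w.2, hw⟩⟩
    · exact (hK.covers h).imp (fun ⟨w, hw⟩ => ⟨w, Or.inr ⟨ha, w.2, hw⟩⟩)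
        fun ⟨w, hw⟩ => ⟨w, Or.inr ⟨hb, w.2, hw⟩⟩

end Glue

variable [Fintype V]

variable (V) in
/-- The pairs of a forest and a maximal matching of it. -/
noncomputable def matchedForests : Finset (SimpleGraph V × SimpleGraph V) :=
  Finset.univ.filter fun p => IsMatchedForest p.1 p.2

variable (V) in
/-- The pairs of a tree and a maximal matching of it. -/
noncomputable def matchedTrees : Finset (SimpleGraph V × SimpleGraph V) :=
  (matchedForests V).filter fun p => p.1.Connected

/-- The set of non-isolated vertices. -/
noncomputable def coveredSet (H : SimpleGraph V) : Finset V :=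
  Finset.univ.filter (· ∈ H.support)

theorem mem_coveredSet {H : SimpleGraph V} {v : V} : v ∈ coveredSet H ↔ v ∈ H.support := by
  simp [coveredSet]

theorem mem_matchedForests {p : SimpleGraph V × SimpleGraph V} :
    p ∈ matchedForests V ↔ IsMatchedForest p.1 p.2 := by
  simp [matchedForests]

theorem mem_matchedTrees {p : SimpleGraph V × SimpleGraph V} :
    p ∈ matchedTrees V ↔ IsMatchedForest p.1 p.2 ∧ p.1.Connected := by
  simp [matchedTrees, mem_matchedForests]

theorem card_coveredSet {H : SimpleGraph V} (h : ∀ ⦃a b c⦄, H.Adj a b → H.Adj a c → b = c) :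
    (coveredSet H).card = 2 * H.edgeSet.ncard := by
  rw [← Nat.card_coe_set_eq, Nat.card_eq_fintype_card, ← SimpleGraph.edgeFinset_card,
    ← H.sum_degrees_eq_twice_card_edges, coveredSet, Finset.card_filter]
  refine Finset.sum_congr rfl fun v _ => ?_
  split_ifs with hv
  · obtain ⟨w, hw⟩ := H.mem_support.1 hv
    refine (SimpleGraph.degree_eq_one_iff_existsUnique_adj.2 ⟨w, hw, fun u hu => ?_⟩).symm
    exact h hu hw
  · symm
    exact Nat.eq_zero_of_not_pos fun h1 =>
      hv (H.mem_support.2 ((H.degree_pos_iff_exists_adj v).1 h1))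

theorem card_matchedTrees_rooted {k : ℕ} (hk : 1 ≤ k) :
    2 * k * ((matchedTrees V).filter fun p => (coveredSet p.2).card = 2 * k).card
      = (Fintype.card V).choose k * (Fintype.card V - k).descFactorial k *
        ((2 * k) ^ (Fintype.card V - 2 * k) * Fintype.card V ^ (k - 1)) := by
  rw [← card_parentFun_lowerEnds hk, mul_comm]
  have h1 : (((matchedTrees V).filter fun p => (coveredSet p.2).card = 2 * k).sigma
      fun p => coveredSet p.2).card =
      ((matchedTrees V).filter fun p => (coveredSet p.2).card = 2 * k).card * (2 * k) := by
    rw [Finset.card_sigma, Finset.sum_const_nat]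
    exact fun p hp => (Finset.mem_filter.1 hp).2
  rw [← h1]
  symm
  refine Finset.card_bij
    (fun p _ => ⟨(parentGraph p.2.1, pairGraph p.2.1 p.1), p.2.2⟩) ?_ ?_ ?_
  · rintro ⟨X, f, r⟩ hp
    simp only [Finset.mem_filter, Finset.mem_univ, true_and] at hp
    obtain ⟨hXk, hf, hX⟩ := hp
    simp only [Finset.mem_sigma, Finset.mem_filter, mem_matchedTrees, mem_coveredSet]
    refine ⟨⟨⟨hX.isMatchedForest hf, hf.connected⟩, ?_⟩, ?_⟩
    · rw [coveredSet, card_support_pairGraph hX, hXk]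
    · rw [support_pairGraph hX.2.1]
      exact Finset.mem_union_right _ hX.2.2.1
  · rintro ⟨X, f, r⟩ hp ⟨X', f', r'⟩ hp' heq
    simp only [Finset.mem_filter, Finset.mem_univ, true_and] at hp hp'
    simp only [Sigma.mk.injEq, Prod.mk.injEq, heq_eq_eq] at heq
    obtain ⟨⟨h2, h3⟩, rfl⟩ := heq
    obtain rfl := hp.2.1.unique hp'.2.1 h2
    have : X = X' := by
      ext x
      rw [hp.2.2.mem_iff hp.2.1, hp'.2.2.mem_iff hp'.2.1, h3]
    rw [this]
  · rintro ⟨⟨F, H⟩, r⟩ hp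
    simp only [Finset.mem_sigma, Finset.mem_filter, mem_matchedTrees, mem_coveredSet] at hp
    obtain ⟨⟨⟨hFH, hconn⟩, hcard⟩, hr⟩ := hp
    obtain ⟨f, hf, rfl⟩ := SimpleGraph.IsTree.exists_parentFun ⟨hconn, hFH.isAcyclic⟩ r
    obtain ⟨X, hX, rfl⟩ := hFH.exists_lowerEnds hf rfl hr
    refine ⟨(X, f, r), ?_, rfl⟩
    simp only [Finset.mem_filter, Finset.mem_univ, true_and]
    refine ⟨?_, hf, hX⟩
    rw [coveredSet, card_support_pairGraph hX] at hcard
    omega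

theorem choose_mul_descFactorial {n k : ℕ} (h : 2 * k ≤ n) :
    n.choose k * (n - k).descFactorial k * (k.factorial * (n - 2 * k).factorial)
      = n.factorial := by
  have h1 := Nat.choose_mul_factorial_mul_factorial (n := n) (k := k) (by omega)
  have h2 := Nat.factorial_mul_descFactorial (n := n - k) (k := k) (by omega)
  rw [show n - k - k = n - 2 * k by omega] at h2
  rw [← h1, ← h2]
  ring

theorem choose_mul_descFactorial_succ (k m : ℕ) :
    (m + 2) * (m + 1) * ((2 * k + 2 + m).choose k * (2 * k + 2 + m - k).descFactorial k)
      = (k + 1) * ((2 * k + 2 + m).choose (k + 1) *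
        (2 * k + 2 + m - (k + 1)).descFactorial (k + 1)) := by
  have h1 := choose_mul_descFactorial (n := 2 * k + 2 + m) (k := k) (by omega)
  have h2 := choose_mul_descFactorial (n := 2 * k + 2 + m) (k := k + 1) (by omega)
  rw [show 2 * k + 2 + m - 2 * k = m + 1 + 1 by omega, Nat.factorial_succ, Nat.factorial_succ]
    at h1
  rw [show 2 * k + 2 + m - 2 * (k + 1) = m by omega, Nat.factorial_succ] at h2
  have h3 : 0 < k.factorial * m.factorial := by positivity
  refine Nat.eq_of_mul_eq_mul_right h3 ?_
  linear_combination h1 - h2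

/-- The number of trees with a maximal matching of `k` edges. -/
noncomputable def treeCount (V : Type*) [Fintype V] (k : ℕ) : ℕ :=
  ((matchedTrees V).filter fun p => (coveredSet p.2).card = 2 * k).card

theorem treeCount_rec {k : ℕ} (hk : 1 ≤ k) (hn : 2 * k + 2 ≤ Fintype.card V) :
    (Fintype.card V : ℝ) * ((Fintype.card V - 2 * k) * (Fintype.card V - 2 * k - 1))
        * treeCount V k
      = 4 * (k + 1) ^ 3 * ((k : ℝ) / (k + 1)) ^ (Fintype.card V - 2 * k - 1)
        * treeCount V (k + 1) := by
  have h1 := card_matchedTrees_rooted (V := V) hk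
  have h2 := card_matchedTrees_rooted (V := V) (k := k + 1) (by omega)
  rw [← treeCount] at h1 h2
  obtain ⟨m, hm⟩ := Nat.exists_eq_add_of_le hn
  obtain ⟨j, rfl⟩ := Nat.exists_eq_add_of_le' hk
  have h3 := choose_mul_descFactorial_succ (j + 1) m
  rw [hm] at h1 h2 ⊢
  generalize treeCount V (j + 1) = x at *
  generalize treeCount V (j + 1 + 1) = y at *
  rw [show 2 * (j + 1) + 2 + m - 2 * (j + 1) = m + 2 by omega] at h1 ⊢
  rw [show 2 * (j + 1) + 2 + m - 2 * (j + 1 + 1) = m by omega] at h2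
  rw [show m + 2 - 1 = m + 1 by omega]
  rw [show j + 1 - 1 = j by omega] at h1
  rw [show j + 1 + 1 - 1 = j + 1 by omega] at h2
  set A := (2 * (j + 1) + 2 + m).choose (j + 1) *
    (2 * (j + 1) + 2 + m - (j + 1)).descFactorial (j + 1)
  set B := (2 * (j + 1) + 2 + m).choose (j + 1 + 1) *
    (2 * (j + 1) + 2 + m - (j + 1 + 1)).descFactorial (j + 1 + 1)
  have h1' : (2 * (j + 1) * x : ℝ)
      = A * ((2 * (j + 1)) ^ (m + 2) * (2 * (j + 1) + 2 + m) ^ j) := by exact_mod_cast h1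
  have h2' : (2 * (j + 1 + 1) * y : ℝ)
      = B * ((2 * (j + 1 + 1)) ^ m * (2 * (j + 1) + 2 + m) ^ (j + 1)) := by exact_mod_cast h2
  have h3' : ((m + 2) * (m + 1) * A : ℝ) = (j + 1 + 1) * B := by exact_mod_cast h3
  clear_value A B
  push_cast
  have hj : (0 : ℝ) < j + 1 := by positivity
  have hj' : (0 : ℝ) < j + 1 + 1 := by positivity
  have hx : (x : ℝ) = A * ((2 * (j + 1)) ^ (m + 1) * (2 * (j + 1) + 2 + m) ^ j) := by
    refine mul_left_cancel₀ (mul_pos two_pos hj).ne' ?_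
    rw [h1']; ring
  have hy : (y : ℝ) = B * ((2 * (j + 1 + 1)) ^ m * (2 * (j + 1) + 2 + m) ^ (j + 1))
      / (2 * (j + 1 + 1)) := by
    rw [← h2']; field_simp
  rw [hx, hy, div_pow]
  have h5 : ((2 * ((j : ℝ) + 1) + 2 + m - 2 * (j + 1)) *
      (2 * ((j : ℝ) + 1) + 2 + m - 2 * (j + 1) - 1)) = (m + 2) * (m + 1) := by ring
  rw [h5]
  calc _ = ((m + 2) * (m + 1) * A : ℝ) *
        ((2 * (j + 1)) ^ (m + 1) * (2 * (j + 1) + 2 + m) ^ (j + 1)) := by ring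
    _ = _ := by
      rw [h3']
      generalize (2 * ((j : ℝ) + 1) + 2 + m) ^ (j + 1) = z
      rw [mul_pow, mul_pow]
      field_simp
      ring

theorem sum_matchedTrees (hn : 2 ≤ Fintype.card V) (g : ℕ → ℝ) :
    ∑ p ∈ matchedTrees V, g (coveredSet p.2).card
      = ∑ k ∈ Finset.Icc 1 (Fintype.card V / 2), treeCount V k * g (2 * k) := by
  rw [← Finset.sum_fiberwise_of_maps_to (t := Finset.Icc 1 (Fintype.card V / 2))
    (g := fun p => p.2.edgeSet.ncard)]
  · refine Finset.sum_congr rfl fun k _ => ?_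
    rw [treeCount, ← nsmul_eq_mul, ← Finset.sum_const]
    refine Finset.sum_congr ?_ ?_
    · refine Finset.filter_congr fun p hp => ?_
      rw [card_coveredSet (mem_matchedTrees.1 hp).1.unique]
      omega
    · intro p hp
      rw [(Finset.mem_filter.1 hp).2]
  · intro p hp
    obtain ⟨hp, hconn⟩ := mem_matchedTrees.1 hp
    have h1 := card_coveredSet hp.unique
    have h2 : (coveredSet p.2).card ≤ Fintype.card V := Finset.card_le_univ _
    have : Nontrivial V := Fintype.one_lt_card_iff_nontrivial.1 hn
    obtain ⟨v⟩ := hconn.nonempty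
    obtain ⟨w, hw⟩ := hconn.preconnected.exists_adj_of_nontrivial v
    have h3 : 0 < (coveredSet p.2).card := by
      rw [Finset.card_pos]
      rcases hp.covers hw with h | h
      · exact ⟨_, mem_coveredSet.2 h⟩
      · exact ⟨_, mem_coveredSet.2 h⟩
    rw [Finset.mem_Icc]
    omega

theorem tree_mean_bound : ∃ l K : ℝ, 0 < l ∧ 0 ≤ K ∧ ∀ (W : Type) [Fintype W] [Nonempty W],
    |∑ p ∈ matchedTrees W, ((coveredSet p.2).card - 2 * l * Fintype.card W : ℝ)|
      ≤ K * (matchedTrees W).card := by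
  obtain ⟨l, K, hl, hK, h⟩ := mean_bound
  refine ⟨l, 2 * K + 2 * l + 1, hl, by positivity, fun W _ _ => ?_⟩
  rcases Nat.lt_or_ge (Fintype.card W) 2 with hW | hW
  · have h1 : Fintype.card W = 1 := by have := Fintype.card_pos (α := W); omega
    refine (Finset.abs_sum_le_sum_abs _ _).trans ?_
    rw [mul_comm (2 * K + 2 * l + 1), ← nsmul_eq_mul]
    refine Finset.sum_le_card_nsmul _ _ _ fun p _ => ?_
    have h2 : (coveredSet p.2).card ≤ 1 := h1 ▸ Finset.card_le_univ _
    have h3 : ((coveredSet p.2).card : ℝ) ≤ 1 := by exact_mod_cast h2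
    have h4 : (0 : ℝ) ≤ (coveredSet p.2).card := by positivity
    rw [h1, abs_le]
    push_cast
    constructor <;> linarith
  · have h1 := h _ hW (fun k => treeCount W k) (fun k => Nat.cast_nonneg _)
      fun k hk hn => treeCount_rec hk hn
    have h2 := sum_matchedTrees hW fun j => (j - 2 * l * Fintype.card W : ℝ)
    have h3 := sum_matchedTrees hW fun _ => (1 : ℝ)
    simp only [Finset.sum_const, nsmul_eq_mul, mul_one] at h3
    rw [h2, h3]
    have h4 : ∑ k ∈ Finset.Icc 1 (Fintype.card W / 2),
        (treeCount W k : ℝ) * (((2 * k : ℕ) : ℝ) - 2 * l * Fintype.card W)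
        = 2 * ∑ k ∈ Finset.Icc 1 (Fintype.card W / 2),
          (treeCount W k : ℝ) * (k - l * Fintype.card W) := by
      rw [Finset.mul_sum]
      refine Finset.sum_congr rfl fun k _ => ?_
      push_cast; ring
    rw [h4, abs_mul, abs_two]
    have h5 : (0 : ℝ) ≤ ∑ k ∈ Finset.Icc 1 (Fintype.card W / 2), (treeCount W k : ℝ) :=
      Finset.sum_nonneg fun k _ => Nat.cast_nonneg _
    calc _ ≤ 2 * (K * ∑ k ∈ Finset.Icc 1 (Fintype.card W / 2), (treeCount W k : ℝ)) :=
          mul_le_mul_of_nonneg_left h1 two_pos.le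
      _ = 2 * K * ∑ k ∈ Finset.Icc 1 (Fintype.card W / 2), (treeCount W k : ℝ) := by ring
      _ ≤ _ := mul_le_mul_of_nonneg_right (by linarith) h5

/-- The vertices reachable from `v`. -/
noncomputable def reachSet (F : SimpleGraph V) (v : V) : Finset V :=
  Finset.univ.filter (F.Reachable v)

theorem mem_reachSet {F : SimpleGraph V} {v w : V} : w ∈ reachSet F v ↔ F.Reachable v w := by
  simp [reachSet]

theorem reachSet_eq {F : SimpleGraph V} {v w : V} (h : F.Reachable v w) :
    reachSet F v = reachSet F w := by
  ext u
  rw [mem_reachSet, mem_reachSet]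
  exact ⟨h.symm.trans, h.trans⟩

/-- The vertex sets of the connected components. -/
noncomputable def components (F : SimpleGraph V) : Finset (Finset V) :=
  Finset.univ.image (reachSet F)

theorem card_mul_components_le (F : SimpleGraph V) :
    Fintype.card V * (components F).card ≤ Fintype.card V +
      (Finset.univ.filter fun d : V × V => ¬ F.Reachable d.1 d.2).card := by
  have h1 : ∀ v, (components F).card ≤ 1 + (Finset.univ.filter fun w => ¬ F.Reachable v w).card := by
    intro v
    have h2 : components F ⊆ insert (reachSet F v)
        ((Finset.univ.filter fun w => ¬ F.Reachable v w).image (reachSet F)) := by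
      intro S hS
      obtain ⟨w, -, rfl⟩ := Finset.mem_image.1 hS
      by_cases hw : F.Reachable v w
      · rw [reachSet_eq hw]; exact Finset.mem_insert_self _ _
      · exact Finset.mem_insert_of_mem (Finset.mem_image_of_mem _ (by simpa using hw))
    refine (Finset.card_le_card h2).trans ((Finset.card_insert_le _ _).trans ?_)
    rw [add_comm]
    exact Nat.add_le_add_left Finset.card_image_le _
  have h3 : (Finset.univ.filter fun d : V × V => ¬ F.Reachable d.1 d.2).card
      = ∑ v, (Finset.univ.filter fun w => ¬ F.Reachable v w).card := by
    simp only [Finset.card_filter]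
    exact Fintype.sum_prod_type _
  have h4 := Finset.sum_le_sum fun v (_ : v ∈ (Finset.univ : Finset V)) => h1 v
  rw [Finset.sum_add_distrib] at h4
  simpa [h3] using h4

theorem card_adj_le [Nonempty V] {F : SimpleGraph V} (hF : F.IsAcyclic) :
    (Finset.univ.filter fun d : V × V => F.Adj d.1 d.2).card ≤ 2 * Fintype.card V := by
  have h1 : (Finset.univ.filter fun d : V × V => F.Adj d.1 d.2).card = ∑ v, F.degree v := by
    simp only [Finset.card_filter]
    rw [Fintype.sum_prod_type]
    refine Finset.sum_congr rfl fun v _ => ?_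
    rw [← Finset.card_filter, ← SimpleGraph.neighborFinset_eq_filter,
      SimpleGraph.card_neighborFinset_eq_degree]
  obtain ⟨T, hFT, -, hT⟩ :=
    (SimpleGraph.connected_top (V := V)).exists_isTree_le_of_le_of_isAcyclic le_top hF
  have h2 := hT.card_edgeFinset
  have h3 := Finset.card_le_card (SimpleGraph.edgeFinset_mono hFT)
  rw [h1, F.sum_degrees_eq_twice_card_edges]
  omega

theorem sum_not_reachable_le :
    ∑ p ∈ matchedForests V, (Finset.univ.filter fun d : V × V => ¬ p.1.Reachable d.1 d.2).card
      ≤ ∑ p ∈ matchedForests V, (Finset.univ.filter fun d : V × V => p.1.Adj d.1 d.2).card := by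
  rw [← Finset.card_sigma, ← Finset.card_sigma]
  refine Finset.card_le_card_of_injOn (fun x => ⟨addEdge x.1 x.2.1 x.2.2, x.2⟩) ?_ ?_
  · rintro ⟨p, v, w⟩ hx
    simp only [Finset.coe_sigma, Set.mem_sigma_iff, Finset.mem_coe, mem_matchedForests,
      Finset.mem_filter_univ] at hx ⊢
    refine ⟨hx.1.addEdge hx.2, Or.inr ?_⟩
    rw [SimpleGraph.edge_adj]
    exact ⟨Or.inl ⟨rfl, rfl⟩, fun h => hx.2 (by rw [h])⟩
  · rintro ⟨p, v, w⟩ hx ⟨q, v', w'⟩ hy heq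
    simp only [Finset.coe_sigma, Set.mem_sigma_iff, Finset.mem_coe, mem_matchedForests,
      Finset.mem_filter_univ] at hx hy
    simp only [Sigma.mk.injEq, heq_eq_eq, Prod.mk.injEq] at heq
    obtain ⟨h1, rfl, rfl⟩ := heq
    rw [addEdge_inj hx.1.le hy.1.le (fun h => hx.2 h.reachable) (fun h => hy.2 h.reachable) h1]

theorem sum_components_le [Nonempty V] :
    ∑ p ∈ matchedForests V, (components p.1).card ≤ 3 * (matchedForests V).card := by
  refine le_of_mul_le_mul_left ?_ (Fintype.card_pos (α := V))
  rw [Finset.mul_sum]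
  have h1 := Finset.sum_le_sum fun p (_ : p ∈ matchedForests V) => card_mul_components_le p.1
  rw [Finset.sum_add_distrib, Finset.sum_const, smul_eq_mul] at h1
  have h2 := Finset.sum_le_sum fun p (hp : p ∈ matchedForests V) =>
    card_adj_le (mem_matchedForests.1 hp).isAcyclic
  rw [Finset.sum_const, smul_eq_mul] at h2
  have h3 := sum_not_reachable_le (V := V)
  linarith

theorem components_partition (F : SimpleGraph V) {S : Finset V} (hS : S ∈ components F) :
    Finset.univ.filter (fun v => reachSet F v = S) = S := by
  obtain ⟨v, -, rfl⟩ := Finset.mem_image.1 hS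
  ext w
  rw [Finset.mem_filter_univ, mem_reachSet]
  exact ⟨fun h => mem_reachSet.1 (h ▸ mem_reachSet.2 .rfl), fun h => (reachSet_eq h).symm⟩

theorem sum_components (F : SimpleGraph V) (g : V → ℝ) :
    ∑ S ∈ components F, ∑ v ∈ S, g v = ∑ v, g v := by
  rw [← Finset.sum_fiberwise_of_maps_to (t := components F) (g := reachSet F)
    fun v hv => Finset.mem_image_of_mem _ hv]
  exact Finset.sum_congr rfl fun S hS => by rw [components_partition F hS]

theorem mem_components_closed {F : SimpleGraph V} {S : Finset V} (hS : S ∈ components F)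
    {a b : V} (h : F.Adj a b) : a ∈ S ↔ b ∈ S := by
  obtain ⟨v, -, rfl⟩ := Finset.mem_image.1 hS
  rw [mem_reachSet, mem_reachSet]
  exact ⟨fun h1 => h1.trans h.reachable, fun h1 => h1.trans h.symm.reachable⟩

theorem card_coveredSet_comap (P : V → Prop) [Fintype (Subtype P)] {H : SimpleGraph V}
    (hP : ∀ ⦃a b⦄, H.Adj a b → P a → P b) :
    (coveredSet (H.comap (Subtype.val : Subtype P → V))).card
      = ((Finset.univ.filter P).filter (· ∈ coveredSet H)).card := by
  rw [← Finset.card_map (Function.Embedding.subtype P)]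
  congr 1
  ext v
  simp only [Finset.mem_map, mem_coveredSet, Function.Embedding.subtype_apply,
    Finset.mem_filter, Finset.mem_univ, true_and]
  constructor
  · rintro ⟨x, hx, rfl⟩
    exact ⟨x.2, support_comap_subtype_iff hP |>.1 hx⟩
  · rintro ⟨h1, h2⟩
    exact ⟨⟨v, h1⟩, (support_comap_subtype_iff hP).2 h2, rfl⟩

theorem connected_comap_component {F : SimpleGraph V} {S : Finset V} (hS : S ∈ components F) :
    (F.comap (Subtype.val : {x // x ∈ S} → V)).Connected := by
  have hcl : ∀ ⦃a b⦄, F.Adj a b → a ∈ S → b ∈ S :=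
    fun a b h => (mem_components_closed hS h).1
  obtain ⟨v, -, rfl⟩ := Finset.mem_image.1 hS
  have hv : v ∈ reachSet F v := mem_reachSet.2 .rfl
  have h1 : ∀ x : {x // x ∈ reachSet F v},
      (F.comap (Subtype.val : {x // x ∈ reachSet F v} → V)).Reachable ⟨v, hv⟩ x :=
    fun x => (reachable_comap_subtype hcl (mem_reachSet.1 x.2) hv).2
  have : Nonempty {x // x ∈ reachSet F v} := ⟨⟨v, hv⟩⟩
  exact ⟨fun x y => (h1 x).symm.trans (h1 y)⟩

theorem mem_components_of_connected {F : SimpleGraph V} {S : Finset V}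
    (hcl : ∀ ⦃a b⦄, F.Adj a b → a ∈ S → b ∈ S)
    (hc : (F.comap (Subtype.val : {x // x ∈ S} → V)).Connected) : S ∈ components F := by
  obtain ⟨v⟩ := hc.nonempty
  refine Finset.mem_image.2 ⟨v, Finset.mem_univ _, ?_⟩
  ext w
  rw [mem_reachSet]
  constructor
  · exact fun h => (reachable_comap_subtype hcl h v.2).1
  · intro hw
    exact (hc.preconnected v ⟨w, hw⟩).map (SimpleGraph.Hom.comap _ _)

/-- A matched forest with component `S` is a matched tree on `S` together with a matched forest
on the complement of `S`. -/
theorem sum_component (S : Finset V) (g : SimpleGraph {x // x ∈ S} → ℝ) :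
    ∑ p ∈ (matchedForests V).filter (fun p => S ∈ components p.1), g (p.2.comap Subtype.val)
      = (matchedForests {x // x ∉ S}).card * ∑ q ∈ matchedTrees {x // x ∈ S}, g q.2 := by
  rw [← nsmul_eq_mul, ← Finset.sum_const, ← Finset.sum_product']
  refine Finset.sum_bij (fun p _ => (restrictPair (· ∉ S) p, restrictPair (· ∈ S) p)) ?_ ?_ ?_ ?_
  · intro p hp
    obtain ⟨hp, hS⟩ := Finset.mem_filter.1 hp
    rw [mem_matchedForests] at hp
    rw [Finset.mem_product, mem_matchedForests, mem_matchedTrees]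
    exact ⟨hp.restrictPair fun a b h => mt (mem_components_closed hS h).2,
      hp.restrictPair fun a b h => (mem_components_closed hS h).1, connected_comap_component hS⟩
  · intro p hp q hq h
    obtain ⟨hp, hpS⟩ := Finset.mem_filter.1 hp
    obtain ⟨hq, hqS⟩ := Finset.mem_filter.1 hq
    rw [mem_matchedForests] at hp hq
    simp only [restrictPair, Prod.mk.injEq] at h
    refine Prod.ext ?_ ?_
    · exact eq_of_comap_subtype (· ∈ S) (fun a b h => mem_components_closed hpS h)
        (fun a b h => mem_components_closed hqS h) h.2.1 h.1.1
    · exact eq_of_comap_subtype (· ∈ S) (fun a b h => mem_components_closed hpS (hp.le h))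
        (fun a b h => mem_components_closed hqS (hq.le h)) h.2.2 h.1.2
  · rintro ⟨r, q⟩ hrq
    rw [Finset.mem_product, mem_matchedForests, mem_matchedTrees] at hrq
    obtain ⟨hr, hq, hc⟩ := hrq
    refine ⟨(glueGraph (· ∈ S) q.1 r.1, glueGraph (· ∈ S) q.2 r.2), ?_, ?_⟩
    · rw [Finset.mem_filter, mem_matchedForests]
      refine ⟨hq.glueGraph hr, mem_components_of_connected
        (fun a b h => (glueGraph_closed h).1) ?_⟩
      convert hc
      exact comap_glueGraph_left
    · simp only [restrictPair]
      rw [comap_glueGraph_left, comap_glueGraph_left]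
      exact Prod.ext (Prod.ext comap_glueGraph_right comap_glueGraph_right) rfl
  · intro p _
    rfl

theorem sum_card_components (g : SimpleGraph V → Finset V → ℝ) :
    ∑ p ∈ matchedForests V, ∑ S ∈ components p.1, g p.2 S
      = ∑ S, ∑ p ∈ (matchedForests V).filter (fun p => S ∈ components p.1), g p.2 S :=
  Finset.sum_comm' (by simp)

theorem forest_mean_bound : ∃ l K : ℝ, 0 < l ∧ 0 ≤ K ∧ ∀ (W : Type) [Fintype W] [Nonempty W],
    |∑ p ∈ matchedForests W, ((coveredSet p.2).card - 2 * l * Fintype.card W : ℝ)|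
      ≤ K * (matchedForests W).card := by
  obtain ⟨l, K, hl, hK, h⟩ := tree_mean_bound
  refine ⟨l, 3 * K, hl, by positivity, fun W _ _ => ?_⟩
  let g : SimpleGraph W → Finset W → ℝ := fun H S =>
    (S.filter (· ∈ coveredSet H)).card - 2 * l * S.card
  have h1 : ∑ p ∈ matchedForests W, ((coveredSet p.2).card - 2 * l * Fintype.card W : ℝ)
      = ∑ p ∈ matchedForests W, ∑ S ∈ components p.1, g p.2 S := by
    refine Finset.sum_congr rfl fun p _ => ?_
    have h2 := sum_components p.1 fun v => (if v ∈ coveredSet p.2 then (1 : ℝ) else 0) - 2 * l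
    simp only [Finset.sum_sub_distrib, Finset.sum_const, nsmul_eq_mul, Finset.sum_boole] at h2
    simp only [g]
    rw [Finset.sum_sub_distrib]
    simp only [mul_comm _ (2 * l), Finset.filter_mem_eq_inter, Finset.univ_inter,
      Finset.card_univ] at h2 ⊢
    exact h2.symm
  have h3 : ∀ S : Finset W,
      |∑ p ∈ (matchedForests W).filter (fun p => S ∈ components p.1), g p.2 S|
        ≤ ∑ p ∈ (matchedForests W).filter (fun p => S ∈ components p.1), K := by
    intro S
    rcases S.eq_empty_or_nonempty with rfl | hS
    · simpa [g] using mul_nonneg (Nat.cast_nonneg _) hK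
    have h4 : ∑ p ∈ (matchedForests W).filter (fun p => S ∈ components p.1), g p.2 S
        = ∑ p ∈ (matchedForests W).filter (fun p => S ∈ components p.1),
          ((coveredSet (p.2.comap (Subtype.val : {x // x ∈ S} → W))).card
            - 2 * l * Fintype.card {x // x ∈ S} : ℝ) := by
      refine Finset.sum_congr rfl fun p hp => ?_
      obtain ⟨hp, hS⟩ := Finset.mem_filter.1 hp
      rw [card_coveredSet_comap (· ∈ S) fun a b hab =>
        (mem_components_closed hS ((mem_matchedForests.1 hp).le hab)).1]
      simp [g]
    have : Nonempty {x // x ∈ S} := hS.to_subtype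
    rw [h4, sum_component S fun H =>
        ((coveredSet H).card - 2 * l * Fintype.card {x // x ∈ S} : ℝ),
      sum_component S fun _ => K, abs_mul, Nat.abs_cast, Finset.sum_const, nsmul_eq_mul,
      mul_comm _ K]
    exact mul_le_mul_of_nonneg_left (h _) (Nat.cast_nonneg _)
  rw [h1, sum_card_components]
  refine (Finset.abs_sum_le_sum_abs _ _).trans ((Finset.sum_le_sum fun S _ => h3 S).trans ?_)
  rw [← sum_card_components fun _ _ => K]
  simp only [Finset.sum_const, nsmul_eq_mul]
  rw [← Finset.sum_mul, mul_comm 3 K, mul_assoc, mul_comm]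
  refine mul_le_mul_of_nonneg_left ?_ hK
  exact_mod_cast sum_components_le (V := W)

end MatchedForest

section MaximalMatching

variable {V : Type*} {G : SimpleGraph V} {M : Set (Sym2 V)}

theorem IsMatching.edgeSet_fromEdgeSet (h : IsMatching G M) :
    (SimpleGraph.fromEdgeSet M).edgeSet = M := by
  rw [SimpleGraph.edgeSet_fromEdgeSet, sdiff_eq_left, Set.disjoint_left]
  exact fun e he => G.not_isDiag_of_mem_edgeSet (h.1 he)

theorem IsMaximalMatching.isMatchedForest (hG : G.IsAcyclic) (h : IsMaximalMatching G M) :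
    IsMatchedForest G (SimpleGraph.fromEdgeSet M) where
  isAcyclic := hG
  le a b hab := h.1.1 ((SimpleGraph.fromEdgeSet_adj M).1 hab).1
  unique a b c hb hc := by
    have hb' := ((SimpleGraph.fromEdgeSet_adj M).1 hb).1
    have hc' := ((SimpleGraph.fromEdgeSet_adj M).1 hc).1
    by_contra hne
    refine h.1.2 _ hb' _ hc' (fun h1 => hne ?_) a (Sym2.mem_mk_left _ _) (Sym2.mem_mk_left _ _)
    exact Sym2.congr_right.1 h1
  covers a b hab := by
    by_contra! hcov
    have hfree : ∀ f ∈ M, a ∉ f ∧ b ∉ f := by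
      have key : ∀ v ∉ (SimpleGraph.fromEdgeSet M).support, ∀ f ∈ M, v ∉ f := by
        rintro v hv f hf ⟨w, rfl⟩
        refine hv (SimpleGraph.mem_support _ |>.2 ⟨w, ?_⟩)
        exact (SimpleGraph.fromEdgeSet_adj M).2 ⟨hf, (h.1.1 hf : G.Adj v w).ne⟩
      exact fun f hf => ⟨key a hcov.1 f hf, key b hcov.2 f hf⟩
    have hdisj : ∀ f ∈ M, ∀ v ∈ s(a, b), v ∉ f := by
      intro f hf v hv
      rcases Sym2.mem_iff.1 hv with rfl | rfl
      · exact (hfree f hf).1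
      · exact (hfree f hf).2
    refine h.2 (insert s(a, b) M) ⟨Set.insert_subset hab h.1.1, ?_⟩
      (Set.ssubset_insert fun h1 => (hfree _ h1).1 (Sym2.mem_mk_left _ _))
    rintro e (rfl | he) f (rfl | hf) hef v hv
    · exact absurd rfl hef
    · exact hdisj f hf v hv
    · exact fun h1 => hdisj e he v h1 hv
    · exact h.1.2 e he f hf hef v hv

theorem IsMatchedForest.isMaximalMatching {H : SimpleGraph V} (h : IsMatchedForest G H) :
    IsMaximalMatching G H.edgeSet := by
  refine ⟨⟨SimpleGraph.edgeSet_mono h.le, ?_⟩, ?_⟩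
  · rintro e he f hf hef v ⟨a, rfl⟩ ⟨b, rfl⟩
    exact hef (by rw [h.unique (SimpleGraph.mem_edgeSet _ |>.1 he) hf])
  · rintro M' hM' hss
    obtain ⟨e, he, heH⟩ := Set.exists_of_ssubset hss
    have key : ∀ v ∈ H.support, v ∉ e := by
      intro v hv hve
      obtain ⟨w, hw⟩ := H.mem_support.1 hv
      have hwH : s(v, w) ∈ H.edgeSet := hw
      exact hM'.2 e he _ (hss.1 hwH) (fun h1 => heH (h1 ▸ hwH)) v hve (Sym2.mem_mk_left _ _)
    induction e using Sym2.ind with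
    | _ a b =>
      exact (h.covers (hM'.1 he)).elim (fun h1 => key a h1 (Sym2.mem_mk_left _ _))
        fun h1 => key b h1 (Sym2.mem_mk_right _ _)

/-- Replacing a matching by the graph formed by its edges. -/
noncomputable def mmSpaceEquiv (n : ℕ) : MMSpace n ≃ matchedForests (Fin n) where
  toFun p := ⟨(p.1.1, SimpleGraph.fromEdgeSet p.1.2),
    mem_matchedForests.2 (p.2.2.isMatchedForest p.2.1)⟩
  invFun q := ⟨(q.1.1, q.1.2.edgeSet), (mem_matchedForests.1 q.2).isAcyclic,
    (mem_matchedForests.1 q.2).isMaximalMatching⟩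
  left_inv p := Subtype.ext (Prod.ext rfl p.2.2.1.edgeSet_fromEdgeSet)
  right_inv _ := Subtype.ext (Prod.ext rfl (SimpleGraph.fromEdgeSet_edgeSet _))

theorem mN_eq (n : ℕ) : mN n = (matchedForests (Fin n)).card := by
  rw [mN, Nat.card_congr (mmSpaceEquiv n), Nat.card_eq_fintype_card, Fintype.card_coe]

theorem two_mul_finsum_ncard (n : ℕ) :
    2 * ∑ᶠ p : MMSpace n, (p.val.2.ncard : ℝ)
      = ∑ p ∈ matchedForests (Fin n), ((coveredSet p.2).card : ℝ) := by
  rw [← finsum_comp_equiv (mmSpaceEquiv n).symm, finsum_eq_sum_of_fintype, Finset.mul_sum,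
    ← Finset.sum_coe_sort (matchedForests (Fin n))]
  refine Finset.sum_congr rfl fun q _ => ?_
  rw [card_coveredSet (mem_matchedForests.1 q.2).unique]
  push_cast
  rfl

theorem matchedForests_nonempty (V : Type*) [Fintype V] : (matchedForests V).Nonempty :=
  ⟨(⊥, ⊥), mem_matchedForests.2 ⟨SimpleGraph.isAcyclic_bot, le_rfl, fun _ _ _ h => h.elim,
    fun _ _ h => h.elim⟩⟩

end MaximalMatching

theorem stmt_15 :
    ∃ lam K : ℝ, 0 < lam ∧ 0 ≤ K ∧
      ∀ n : ℕ, 1 ≤ n → |Ebar n - lam * (n : ℝ)| ≤ K := by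
  obtain ⟨l, K, hl, hK, h⟩ := forest_mean_bound
  refine ⟨l, K, hl, hK, fun n hn => ?_⟩
  have : Nonempty (Fin n) := ⟨⟨0, hn⟩⟩
  have h1 := h (Fin n)
  have hm : (0 : ℝ) < (matchedForests (Fin n)).card :=
    Nat.cast_pos.2 (matchedForests_nonempty _).card_pos
  rw [Finset.sum_sub_distrib, ← two_mul_finsum_ncard, Finset.sum_const, nsmul_eq_mul,
    Fintype.card_fin] at h1
  have h2 : Ebar n - l * n = (2 * ∑ᶠ p : MMSpace n, (p.val.2.ncard : ℝ)
      - (matchedForests (Fin n)).card * (2 * l * n)) / (2 * (matchedForests (Fin n)).card) := by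
    rw [Ebar, mN_eq]
    field_simp
  rw [h2, abs_div, abs_of_pos (mul_pos two_pos hm), div_le_iff₀ (mul_pos two_pos hm)]
  refine h1.trans ?_
  nlinarith [mul_nonneg hK hm.le]
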